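/- arXiv:2501.14924 — 3 statements merged into one kernel-verified Lean document; each statement's English description precedes it below -/
import Mathlib

section
/- Let q be a prime power, d ≥ 2 an integer, and n a positive integer. A cyclic ((q^d−1)/(q−1), n, q^{d−1}, q^{d−2}(q−1)/n)-relative difference set exists if and only if n divides q−1 when q is odd or d is even, and if and only if n divides 2(q−1) when q is even and d is odd. -/
/-- Additive version: `R` is an `(m,n,k,l)`-relative difference set in the abelian group `G`
relative to the subgroup `N` of order `n` (every subgroup of an abelian group is normal). -/
def IsAddRDS {G : Type*} [AddCommGroup G] (m n k l : ℕ) (N : AddSubgroup G) (R : Set G) : Prop :=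
  Nat.card G = m * n ∧ Nat.card N = n ∧ R.ncard = k ∧
    (∀ g : G, g ∉ N → {p : G × G | p.1 ∈ R ∧ p.2 ∈ R ∧ p.1 - p.2 = g}.ncard = l) ∧
    (∀ g : G, g ∈ N → g ≠ 0 → {p : G × G | p.1 ∈ R ∧ p.2 ∈ R ∧ p.1 - p.2 = g}.ncard = 0)

/-- A cyclic `(m,n,k,l)`-relative difference set exists: an RDS in `ZMod (m*n)` relative to its
unique subgroup of order `n`, the subgroup of multiples of `m`. -/
def IsCyclicAddRDS (m n k l : ℕ) : Prop :=
  ∃ R : Set (ZMod (m * n)),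
    IsAddRDS m n k l (AddSubgroup.zmultiples ((m : ZMod (m * n)))) R

theorem IsAddRDS.map {G G' : Type*} [AddCommGroup G] [AddCommGroup G'] [Finite G]
    {m n k l : ℕ} {N : AddSubgroup G} {R : Set G} (h : IsAddRDS m n k l N R)
    (π : G →+ G') (hπ : Function.Surjective π) (hker : π.ker ≤ N) {c n' : ℕ}
    (hc : Nat.card π.ker = c) (hn : n = c * n') :
    IsAddRDS m n' k (c * l) (N.map π) (π '' R) := by
  classical
  obtain ⟨hG, hN, hR, hl, h0⟩ := h
  have := Fintype.ofFinite G
  have hcpos : 0 < c := hc ▸ Nat.card_pos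
  have hinj : Set.InjOn π R := by
    intro a ha b hb hab
    by_contra hne
    have hk : a - b ∈ π.ker := by simp [AddMonoidHom.mem_ker, hab]
    have := h0 (a - b) (hker hk) (sub_ne_zero.mpr hne)
    rw [Set.ncard_eq_zero (Set.toFinite _)] at this
    exact this.subset (show (a, b) ∈ _ from ⟨ha, hb, rfl⟩)
  have hpairs : ∀ g' : G', {p : G' × G' | p.1 ∈ π '' R ∧ p.2 ∈ π '' R ∧ p.1 - p.2 = g'}.ncard
      = ∑ g ∈ Finset.univ.filter (fun g => π g = g'),
        {p : G × G | p.1 ∈ R ∧ p.2 ∈ R ∧ p.1 - p.2 = g}.ncard := by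
    intro g'
    have e1 : {p : G' × G' | p.1 ∈ π '' R ∧ p.2 ∈ π '' R ∧ p.1 - p.2 = g'}
        = Prod.map π π '' {p : G × G | p.1 ∈ R ∧ p.2 ∈ R ∧ π (p.1 - p.2) = g'} := by
      ext ⟨a, b⟩
      constructor
      · rintro ⟨⟨x, hx, rfl⟩, ⟨y, hy, rfl⟩, hxy⟩
        exact ⟨(x, y), ⟨hx, hy, by simpa using hxy⟩, rfl⟩
      · rintro ⟨⟨x, y⟩, ⟨hx, hy, hxy⟩, hab⟩
        simp only [Prod.map_apply, Prod.mk.injEq] at hab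
        obtain ⟨rfl, rfl⟩ := hab
        exact ⟨⟨x, hx, rfl⟩, ⟨y, hy, rfl⟩, by simpa using hxy⟩
    rw [e1, Set.InjOn.ncard_image]
    · simp_rw [Set.ncard_eq_toFinset_card']
      rw [Finset.card_eq_sum_card_fiberwise (f := fun p : G × G => p.1 - p.2)
        (t := Finset.univ.filter (fun g => π g = g'))]
      · refine Finset.sum_congr rfl fun g hg => congrArg _ ?_
        ext p
        simp only [Finset.mem_filter, Set.mem_toFinset, Set.mem_ofPred_eq, Finset.mem_univ,
          true_and] at hg ⊢
        constructor
        · rintro ⟨⟨h1, h2, -⟩, h3⟩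
          exact ⟨h1, h2, h3⟩
        · rintro ⟨h1, h2, h3⟩
          exact ⟨⟨h1, h2, by rw [h3, hg]⟩, h3⟩
      · intro p hp
        simpa using (Set.mem_toFinset.mp hp).2.2
    · rintro ⟨a, b⟩ ⟨ha, hb, -⟩ ⟨a', b'⟩ ⟨ha', hb', -⟩ hab
      simp only [Prod.map_apply, Prod.mk.injEq] at hab
      exact Prod.ext (hinj ha ha' hab.1) (hinj hb hb' hab.2)
  have hmem : ∀ g, π g ∈ N.map π ↔ g ∈ N := by
    intro g
    constructor
    · rintro ⟨x, hx, hxg⟩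
      have : g - x ∈ N := hker (by simp [AddMonoidHom.mem_ker, hxg])
      simpa using N.add_mem this hx
    · exact fun hg => ⟨g, hg, rfl⟩
  refine ⟨?_, ?_, ?_, ?_, ?_⟩
  · have h1 := AddSubgroup.card_mul_index π.ker
    rw [AddSubgroup.index_ker, AddMonoidHom.range_eq_top.mpr hπ, AddSubgroup.card_top, hc, hG,
      hn] at h1
    exact Nat.eq_of_mul_eq_mul_left hcpos (by rw [h1]; ring)
  · have h1 := AddSubgroup.card_mul_index (π.comp N.subtype).ker
    have h2 : Nat.card (π.comp N.subtype).ker = c := by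
      rw [← hc]
      refine Nat.card_congr
        ⟨fun x => ⟨x.1.1, x.2⟩, fun x => ⟨⟨x.1, hker x.2⟩, x.2⟩, fun x => rfl, fun x => rfl⟩
    rw [AddSubgroup.index_ker, h2, AddMonoidHom.range_comp, AddSubgroup.range_subtype, hN, hn]
      at h1
    exact Nat.eq_of_mul_eq_mul_left hcpos h1
  · rw [hinj.ncard_image, hR]
  · intro g' hg'
    rw [hpairs]
    obtain ⟨g, rfl⟩ := hπ g'
    rw [Finset.sum_congr rfl (g := fun _ => l), Finset.sum_const, smul_eq_mul]
    · congr 1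
      rw [← hc, ← Fintype.card_subtype, ← Nat.card_eq_fintype_card]
      refine Nat.card_congr ⟨fun x => ⟨x.1 - g, ?_⟩, fun x => ⟨x.1 + g, ?_⟩, fun x => ?_,
        fun x => ?_⟩
      · simp [AddMonoidHom.mem_ker, x.2]
      · simp [(AddMonoidHom.mem_ker).mp x.2]
      · simp
      · simp
    · intro x hx
      refine hl x fun hxN => hg' ?_
      rw [← (Finset.mem_filter.mp hx).2]
      exact (hmem x).mpr hxN
  · intro g' hg' hne
    rw [hpairs]
    refine Finset.sum_eq_zero fun x hx => ?_
    have hx' := (Finset.mem_filter.mp hx).2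
    refine h0 x ((hmem x).mp (hx' ▸ hg')) ?_
    rintro rfl
    exact hne (by simpa using hx'.symm)

theorem IsAddCyclic.mem_iff_card_nsmul_eq_zero {G : Type*} [AddCommGroup G] [Finite G]
    [IsAddCyclic G] (N : AddSubgroup G) (x : G) : x ∈ N ↔ Nat.card N • x = 0 := by
  classical
  have := Fintype.ofFinite G
  have hsub : Finset.univ.filter (· ∈ N) ⊆ Finset.univ.filter (fun x => Nat.card N • x = 0) := by
    intro x hx
    simp only [Finset.mem_filter, Finset.mem_univ, true_and] at hx ⊢
    exact congrArg Subtype.val (card_nsmul_eq_zero' (x := (⟨x, hx⟩ : N)))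
  have heq := Finset.eq_of_subset_of_card_le hsub <| by
    refine (IsAddCyclic.card_nsmul_eq_zero_le (Nat.card_pos (α := N))).trans ?_
    rw [Nat.card_eq_fintype_card, Fintype.card_subtype]
  simpa using congrArg (x ∈ ·) heq

theorem IsAddRDS.isCyclicAddRDS {G : Type*} [AddCommGroup G] [Finite G] [IsAddCyclic G]
    {m c n k l : ℕ} {N : AddSubgroup G} {R : Set G} (h : IsAddRDS m (c * n) k l N R) :
    IsCyclicAddRDS m n k (c * l) := by
  have hG : Nat.card G = (m * n) * c := by rw [h.1]; ring
  have hpos : (m * n) * c ≠ 0 := hG ▸ Nat.card_pos.ne'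
  have : NeZero (m * n) := ⟨left_ne_zero_of_mul hpos⟩
  let e : ZMod (Nat.card G) ≃+ G := zmodAddCyclicAddEquiv inferInstance
  have hdvd : m * n ∣ Nat.card G := hG ▸ Dvd.intro c rfl
  let π : G →+ ZMod (m * n) :=
    (ZMod.castHom hdvd (ZMod (m * n))).toAddMonoidHom.comp e.symm.toAddMonoidHom
  have hπ : Function.Surjective π :=
    (ZMod.castHom_surjective hdvd).comp e.symm.surjective
  have hcard : Nat.card π.ker = c := by
    have h1 := AddSubgroup.card_mul_index π.ker
    rw [AddSubgroup.index_ker, AddMonoidHom.range_eq_top.mpr hπ, AddSubgroup.card_top, hG,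
      Nat.card_zmod, mul_comm] at h1
    exact Nat.eq_of_mul_eq_mul_left (Nat.pos_of_ne_zero (NeZero.ne _)) h1
  have hker : π.ker ≤ N := by
    intro x hx
    rw [IsAddCyclic.mem_iff_card_nsmul_eq_zero, hcard] at hx
    rw [IsAddCyclic.mem_iff_card_nsmul_eq_zero, h.2.1, mul_nsmul, hx, nsmul_zero]
  have hmap := h.map π hπ hker hcard rfl
  have hN : N.map π = AddSubgroup.zmultiples ((m : ZMod (m * n))) := by
    ext x
    rw [IsAddCyclic.mem_iff_card_nsmul_eq_zero, hmap.2.1,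
      IsAddCyclic.mem_iff_card_nsmul_eq_zero (AddSubgroup.zmultiples _), Nat.card_zmultiples,
      ZMod.addOrderOf_coe _ (NeZero.ne _), Nat.gcd_mul_right_left,
      Nat.mul_div_cancel_left _ (Nat.pos_of_ne_zero (left_ne_zero_of_mul (NeZero.ne (m * n))))]
  rw [hN] at hmap
  exact ⟨_, hmap⟩

theorem IsCyclicAddRDS.exists_prod {m c n k l : ℕ} (h : IsCyclicAddRDS m (c * n) k l)
    (hpos : m * (c * n) ≠ 0) (hmn : m.Coprime n) :
    ∃ R : Set (ZMod m × ZMod n),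
      IsAddRDS m n k (c * l) (AddMonoidHom.fst (ZMod m) (ZMod n)).ker R := by
  obtain ⟨R, hR⟩ := h
  have : NeZero (m * (c * n)) := ⟨hpos⟩
  have : NeZero n := ⟨right_ne_zero_of_mul (right_ne_zero_of_mul hpos)⟩
  have : NeZero m := ⟨left_ne_zero_of_mul hpos⟩
  have hdvd : m * n ∣ m * (c * n) := mul_dvd_mul_left m (Dvd.intro_left c rfl)
  let e := ZMod.chineseRemainder hmn
  let π : ZMod (m * (c * n)) →+ ZMod m × ZMod n :=
    e.toAddEquiv.toAddMonoidHom.comp (ZMod.castHom hdvd (ZMod (m * n))).toAddMonoidHom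
  have hπ : Function.Surjective π :=
    e.surjective.comp (ZMod.castHom_surjective hdvd)
  have hcard : Nat.card π.ker = c := by
    have h1 := AddSubgroup.card_mul_index π.ker
    rw [AddSubgroup.index_ker, AddMonoidHom.range_eq_top.mpr hπ, AddSubgroup.card_top,
      Nat.card_prod, Nat.card_zmod, Nat.card_zmod, Nat.card_zmod] at h1
    refine Nat.eq_of_mul_eq_mul_right (Nat.pos_of_ne_zero (NeZero.ne (m * n))) (h1.trans ?_)
    ring
  have hker : π.ker ≤ AddSubgroup.zmultiples ((m : ZMod (m * (c * n)))) := by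
    intro x hx
    rw [IsAddCyclic.mem_iff_card_nsmul_eq_zero, hcard] at hx
    rw [IsAddCyclic.mem_iff_card_nsmul_eq_zero, hR.2.1, mul_nsmul, hx, nsmul_zero]
  have hmap := hR.map π hπ hker hcard rfl
  have : IsAddCyclic (ZMod m × ZMod n) :=
    isAddCyclic_of_surjective e.toAddEquiv.toAddMonoidHom e.surjective
  have hN : (AddSubgroup.zmultiples ((m : ZMod (m * (c * n))))).map π
      = (AddMonoidHom.fst (ZMod m) (ZMod n)).ker := by
    ext x
    rw [IsAddCyclic.mem_iff_card_nsmul_eq_zero, hmap.2.1,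
      IsAddCyclic.mem_iff_card_nsmul_eq_zero (AddMonoidHom.ker _)]
    have h1 := AddSubgroup.card_mul_index (AddMonoidHom.fst (ZMod m) (ZMod n)).ker
    rw [AddSubgroup.index_ker, AddMonoidHom.range_eq_top.mpr Prod.fst_surjective,
      AddSubgroup.card_top, Nat.card_prod, Nat.card_zmod, Nat.card_zmod, mul_comm] at h1
    rw [Nat.eq_of_mul_eq_mul_left (Nat.pos_of_ne_zero (NeZero.ne m)) h1]
  rw [hN] at hmap
  exact ⟨_, hmap⟩

theorem pow_succ_dvd_pow_pow_sub_pow_pow {S : Type*} [CommRing S] {π : S} {J : ℕ}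
    (hJ : π ∣ (J : S)) {a b : S} (h : π ∣ a - b) (r : ℕ) :
    π ^ (r + 1) ∣ a ^ J ^ r - b ^ J ^ r := by
  induction r with
  | zero => simpa using h
  | succ r ih =>
    have h1 : π ∣ a ^ J ^ r - b ^ J ^ r := (dvd_pow_self π r.succ_ne_zero).trans ih
    rw [pow_succ J, pow_mul, pow_mul, ← geom_sum₂_mul, pow_succ' π]
    exact mul_dvd_mul ((dvd_geom_sum₂_iff_of_dvd_sub h1).mpr (hJ.mul_right _)) ih

/-- If `τ` is trivial modulo `π` and `S / π` is reduced (in the strong form of a Frobenius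
identity), then `x` and `τ x` are divisible by the same powers of `π` locally. -/
theorem pow_dvd_map_mul_of_pow_dvd_mul {S : Type*} [CommRing S] (τ : S →+* S) {π : S}
    (hreg : IsLeftRegular π) (hτ : ∀ x, π ∣ τ x - x) {t : ℕ} (hJ : π ∣ ((t + 2 : ℕ) : S))
    (hfrob : ∀ x : S, π ∣ x ^ (t + 2) - x) (k : ℕ) (x y : S) (h : π ^ k ∣ x * y) :
    π ^ k ∣ τ x * y := by
  induction k generalizing x y with
  | zero => simp
  | succ k ih =>
    obtain ⟨e, he⟩ : ∃ e, e = (x ^ (t + 1)) ^ (t + 2) ^ k := ⟨_, rfl⟩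
    have hidem : π ^ (k + 1) ∣ e * (1 - e) := by
      have h1 : π ∣ x ^ (t + 1) - (x ^ (t + 1)) ^ 2 := by
        have : x ^ (t + 1) - (x ^ (t + 1)) ^ 2 = -(x ^ t * (x ^ (t + 2) - x)) := by ring
        rw [this]
        exact (dvd_mul_of_dvd_right (hfrob x) _).neg_right
      have h2 := pow_succ_dvd_pow_pow_sub_pow_pow hJ h1 k
      rw [pow_right_comm _ 2, ← he] at h2
      convert h2 using 1
      ring
    have hτe : π ^ (k + 1) ∣ τ e - e := by
      rw [he, map_pow]
      exact pow_succ_dvd_pow_pow_sub_pow_pow hJ (hτ _) k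
    obtain ⟨w, hw⟩ : x ∣ e := by
      rw [he]
      exact (dvd_pow_self x t.succ_ne_zero).trans (dvd_pow_self _ (pow_ne_zero _ (by omega)))
    obtain ⟨x', hx'⟩ : π ∣ x * (1 - e) := by
      rw [he]
      generalize (t + 2) ^ k = s
      induction s with
      | zero => simp
      | succ s ihs =>
        have : x * (1 - (x ^ (t + 1)) ^ (s + 1))
            = x * (1 - (x ^ (t + 1)) ^ s) - (x ^ (t + 1)) ^ s * (x ^ (t + 2) - x) := by ring
        rw [this]
        exact dvd_sub ihs (dvd_mul_of_dvd_right (hfrob x) _)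
    have h1 : π ^ k ∣ x' * (y * (1 - e)) := by
      have h2 : π ^ (k + 1) ∣ π * (x' * (y * (1 - e))) := by
        have : π * (x' * (y * (1 - e))) = x * y * (1 - e) ^ 2 := by
          rw [← mul_assoc, ← hx']; ring
        rw [this]
        exact h.mul_right _
      rw [pow_succ'] at h2
      obtain ⟨z, hz⟩ := h2
      rw [mul_assoc] at hz
      exact ⟨z, hreg hz⟩
    have hτx : τ x * (1 - τ e) = τ π * τ x' := by
      rw [← map_mul, ← hx']; simp
    have hτπ : π ∣ τ π := by simpa using dvd_add (hτ π) (dvd_refl π)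
    have key : τ x * y = τ x * w * (x * y) + τ π * (τ x' * (y * (1 - e)))
        + τ x * y * ((τ e - e) * (1 - e) + e * (1 - e)) := by
      rw [← mul_assoc (τ π), ← hτx]
      linear_combination (τ x * y) * hw
    rw [key]
    refine dvd_add (dvd_add (h.mul_left _) ?_) (dvd_mul_of_dvd_right (dvd_add (hτe.mul_right _)
      hidem) _)
    rw [pow_succ']
    exact mul_dvd_mul hτπ (ih _ _ h1)

section Prod

variable {A B : Type*} [AddCommGroup A] [AddCommGroup B] {m n k l : ℕ} {F : Finset (A × B)}

theorem AddMonoidHom.mem_ker_fst_iff {g : A × B} : g ∈ (AddMonoidHom.fst A B).ker ↔ g.1 = 0 :=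
  Iff.rfl

theorem IsAddRDS.eq_of_fst_eq [Finite A] [Finite B]
    (h : IsAddRDS m n k l (AddMonoidHom.fst A B).ker (F : Set (A × B)))
    {r s : A × B} (hr : r ∈ F) (hs : s ∈ F) (hrs : r.1 = s.1) : r = s := by
  by_contra hne
  have := h.2.2.2.2 (r - s) (AddMonoidHom.mem_ker_fst_iff.mpr (sub_eq_zero.mpr hrs))
    (sub_ne_zero.mpr hne)
  rw [Set.ncard_eq_zero (Set.toFinite _)] at this
  exact this.subset (show (r, s) ∈ _ from ⟨hr, hs, rfl⟩)

theorem IsAddRDS.exists_sub_eq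
    (h : IsAddRDS m n k l (AddMonoidHom.fst A B).ker (F : Set (A × B)))
    (hl : l ≠ 0) {g : A × B} (hg : g.1 ≠ 0) : ∃ r ∈ F, ∃ s ∈ F, r - s = g := by
  have := h.2.2.2.1 g (mt AddMonoidHom.mem_ker_fst_iff.mp hg)
  obtain ⟨⟨r, s⟩, hr, hs, hrs⟩ := Set.nonempty_of_ncard_ne_zero (this.trans_ne hl)
  exact ⟨r, hr, s, hs, hrs⟩

theorem IsAddRDS.sum_mul_sum [Fintype A] [Fintype B] {S : Type*} [CommRing S]
    (h : IsAddRDS m n k l (AddMonoidHom.fst A B).ker (F : Set (A × B)))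
    (α : AddChar A S) (β : AddChar B S) (hβ : ∑ b, β b = 0) :
    (∑ r ∈ F, α r.1 * β r.2) * (∑ r ∈ F, α (-r.1) * β (-r.2)) = k := by
  classical
  have hcount : ∀ g : A × B, ((F ×ˢ F).filter (fun p => p.1 - p.2 = g)).card
      = {p : (A × B) × (A × B) | p.1 ∈ (F : Set (A × B)) ∧ p.2 ∈ (F : Set (A × B)) ∧
          p.1 - p.2 = g}.ncard := by
    intro g
    rw [← Set.ncard_coe_finset]
    congr 1
    ext p
    simp [and_assoc]
  have hzero : ((F ×ˢ F).filter (fun p => p.1 - p.2 = 0)).card = k := by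
    rw [← h.2.2.1, Set.ncard_coe_finset]
    refine Finset.card_bij' (fun p _ => p.1) (fun r _ => (r, r)) ?_ ?_ ?_ ?_
    · intro p hp
      exact (Finset.mem_product.mp (Finset.mem_filter.mp hp).1).1
    · intro r hr
      simp [hr]
    · intro p hp
      exact Prod.ext rfl (sub_eq_zero.mp (Finset.mem_filter.mp hp).2)
    · intro r hr
      rfl
  have hT : ∀ g : A × B, ((F ×ˢ F).filter (fun p => p.1 - p.2 = g)).card
      = (if g = 0 then k else 0) + (l * if g.1 = 0 then 0 else 1) := by
    intro g
    by_cases hg : g = 0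
    · subst hg
      simp [hzero]
    · rw [hcount]
      by_cases hg1 : g.1 = 0
      · rw [h.2.2.2.2 g (AddMonoidHom.mem_ker_fst_iff.mpr hg1) hg]
        simp [hg, hg1]
      · rw [h.2.2.2.1 g (mt AddMonoidHom.mem_ker_fst_iff.mp hg1)]
        simp [hg, hg1]
  calc (∑ r ∈ F, α r.1 * β r.2) * (∑ r ∈ F, α (-r.1) * β (-r.2))
      = ∑ p ∈ F ×ˢ F, α (p.1 - p.2).1 * β (p.1 - p.2).2 := by
        rw [Finset.sum_mul_sum, ← Finset.sum_product']
        refine Finset.sum_congr rfl fun p _ => ?_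
        rw [sub_eq_add_neg, Prod.fst_add, Prod.snd_add, Prod.fst_neg, Prod.snd_neg,
          AddChar.map_add_eq_mul, AddChar.map_add_eq_mul]
        ring
    _ = ∑ g : A × B, ((F ×ˢ F).filter (fun p => p.1 - p.2 = g)).card * (α g.1 * β g.2) := by
        rw [← Finset.sum_fiberwise_of_maps_to (g := fun p : (A × B) × (A × B) => p.1 - p.2)
          (t := Finset.univ) (fun _ _ => Finset.mem_univ _)]
        refine Finset.sum_congr rfl fun g _ => ?_
        rw [Finset.sum_congr rfl (g := fun _ => α g.1 * β g.2), Finset.sum_const, nsmul_eq_mul]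
        intro p hp
        rw [(Finset.mem_filter.mp hp).2]
    _ = k + l * ((∑ a : A, if a = 0 then 0 else α a) * ∑ b, β b) := by
        rw [Finset.sum_mul_sum, ← Finset.sum_product', Finset.mul_sum]
        simp_rw [hT]
        push_cast
        simp_rw [add_mul]
        rw [Finset.sum_add_distrib]
        congr 1
        · simp
        · refine Finset.sum_congr rfl fun g _ => ?_
          split_ifs <;> simp
    _ = k := by rw [hβ]; simp

end Prod

section Cyclotomic

open NumberField

theorem Complex.eq_of_sum_eq_natCast_mul {ι : Type*} {s : Finset ι} {u : ι → ℂ} {w : ℂ} {k : ℕ}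
    (hu : ∀ i ∈ s, ‖u i‖ = 1) (hw : ‖w‖ = 1) (hs : s.card ≤ k) (h : ∑ i ∈ s, u i = k * w) :
    s.card = k ∧ ∀ i ∈ s, u i = w := by
  have hww : w * (starRingEnd ℂ) w = 1 := by
    rw [Complex.mul_conj, Complex.normSq_eq_norm_sq, hw]; simp
  have hn : ∀ i ∈ s, ‖u i * (starRingEnd ℂ) w‖ = 1 := by
    intro i hi
    rw [norm_mul, hu i hi, RCLike.norm_conj, hw, one_mul]
  have hre : ∀ i ∈ s, (u i * (starRingEnd ℂ) w).re ≤ 1 := fun i hi =>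
    (Complex.re_le_norm _).trans (hn i hi).le
  have hsum : ∑ i ∈ s, (u i * (starRingEnd ℂ) w).re = k := by
    rw [← Complex.re_sum, ← Finset.sum_mul, h, mul_assoc, hww]; simp
  have hle : (k : ℝ) ≤ s.card := by
    rw [← hsum]
    exact (Finset.sum_le_sum hre).trans (by simp)
  have hcard : s.card = k := le_antisymm hs (by exact_mod_cast hle)
  refine ⟨hcard, fun i hi => ?_⟩
  have h1 := (Finset.sum_eq_sum_iff_of_le hre).mp (by rw [hsum]; simp [hcard]) i hi
  have h2 : u i * (starRingEnd ℂ) w = 1 := by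
    have h3 := hn i hi
    rw [← sq_eq_sq₀ (norm_nonneg _) zero_le_one, ← Complex.normSq_eq_norm_sq,
      Complex.normSq_apply, h1] at h3
    refine Complex.ext h1 ?_
    have : (u i * (starRingEnd ℂ) w).im * (u i * (starRingEnd ℂ) w).im = 0 := by linarith
    simpa using mul_self_eq_zero.mp this
  calc u i = u i * (w * (starRingEnd ℂ) w) := by rw [hww, mul_one]
    _ = (u i * (starRingEnd ℂ) w) * w := by ring
    _ = w := by rw [h2, one_mul]

theorem NumberField.eq_of_sum_rootsOfUnity_eq {K : Type*} [Field K] [NumberField K] {ι : Type*}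
    {s : Finset ι} {u : ι → 𝓞 K} {n : ℕ} (hn : n ≠ 0) (hu : ∀ i ∈ s, u i ^ n = 1) {k : ℕ}
    (hs : s.card ≤ k) (hk : k ≠ 0) {E : 𝓞 K} (hE : E ≠ 0) (h : ∑ i ∈ s, u i = k * E) :
    s.card = k ∧ ∀ i ∈ s, u i = E := by
  have hu' : ∀ φ : K →+* ℂ, ∀ i ∈ s, ‖φ (u i)‖ = 1 := by
    intro φ i hi
    have h1 : φ (u i) ^ n = 1 := by
      rw [← map_pow, ← map_pow, hu i hi]; simp
    exact Complex.norm_eq_one_of_pow_eq_one h1 hn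
  have hsum : ∀ φ : K →+* ℂ, ∑ i ∈ s, φ (u i) = k * φ E := by
    intro φ
    rw [← map_sum, ← map_sum, h]; simp
  have hE1 : ∀ φ : K →+* ℂ, ‖φ E‖ ≤ 1 := by
    intro φ
    have h1 : (k : ℝ) * ‖φ E‖ ≤ k * 1 := by
      calc (k : ℝ) * ‖φ E‖ = ‖∑ i ∈ s, φ (u i)‖ := by rw [hsum φ, norm_mul, Complex.norm_natCast]
        _ ≤ ∑ i ∈ s, ‖φ (u i)‖ := norm_sum_le _ _
        _ = s.card := by rw [Finset.sum_congr rfl (hu' φ)]; simp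
        _ ≤ k * 1 := by rw [mul_one]; exact_mod_cast hs
    exact le_of_mul_le_mul_left h1 (by exact_mod_cast Nat.pos_of_ne_zero hk)
  obtain ⟨m, hm, hEm⟩ := NumberField.Embeddings.pow_eq_one_of_norm_le_one K ℂ
    (x := (E : K)) (by simpa using hE) (RingOfIntegers.isIntegral_coe E) hE1
  obtain ⟨φ⟩ : Nonempty (K →+* ℂ) := inferInstance
  have hEφ : ‖φ E‖ = 1 :=
    Complex.norm_eq_one_of_pow_eq_one (by rw [← map_pow, hEm, map_one]) hm.ne'
  obtain ⟨h1, h2⟩ := Complex.eq_of_sum_eq_natCast_mul (hu' φ) hEφ hs (hsum φ)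
  exact ⟨h1, fun i hi => RingOfIntegers.coe_injective (φ.injective (h2 i hi))⟩

variable {K : Type*} [Field K] [NumberField K] {n : ℕ} [NeZero n] [IsCyclotomicExtension {n} ℚ K]
  {ζ : K} (hζ : IsPrimitiveRoot ζ n)
include hζ

theorem IsPrimitiveRoot.exists_toInteger_sub_one_dvd_sub_intCast (x : 𝓞 K) :
    ∃ z : ℤ, hζ.toInteger - 1 ∣ x - z := by
  have hx : x ∈ Algebra.adjoin ℤ {hζ.toInteger} := by
    rw [← hζ.integralPowerBasis_gen, hζ.integralPowerBasis.adjoin_gen_eq_top]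
    trivial
  induction hx using Algebra.adjoin_induction with
  | mem x hx => exact ⟨1, by rw [Set.mem_singleton_iff.mp hx]; simp⟩
  | algebraMap z => exact ⟨z, by simp⟩
  | add x y _ _ hx hy =>
    obtain ⟨a, ha⟩ := hx
    obtain ⟨b, hb⟩ := hy
    exact ⟨a + b, by push_cast; rw [add_sub_add_comm]; exact dvd_add ha hb⟩
  | mul x y _ _ hx hy =>
    obtain ⟨a, ha⟩ := hx
    obtain ⟨b, hb⟩ := hy
    refine ⟨a * b, ?_⟩
    have : x * y - (a * b : ℤ) = (x - a) * y + a * (y - b) := by push_cast; ring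
    rw [this]
    exact dvd_add (ha.mul_right _) (hb.mul_left _)

theorem IsPrimitiveRoot.exists_ringHom_toInteger_mul_eq_one :
    ∃ τ : 𝓞 K →+* 𝓞 K, τ hζ.toInteger * hζ.toInteger = 1 := by
  have : IsGalois ℚ K := IsCyclotomicExtension.isGalois {n} ℚ K
  let σ : Gal(K/ℚ) := (IsCyclotomicExtension.Rat.galEquivZMod n K).symm (-1)
  have hpow : hζ.toInteger ^ n = 1 := hζ.toInteger_isPrimitiveRoot.pow_eq_one
  have h := IsCyclotomicExtension.Rat.galEquivZMod_smul_of_pow_eq n K σ hpow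
  refine ⟨MulSemiringAction.toRingHom Gal(K/ℚ) (𝓞 K) σ, ?_⟩
  rw [MulSemiringAction.toRingHom_apply, h, ← pow_succ]
  rw [hζ.toInteger_isPrimitiveRoot.pow_eq_one_iff_dvd, ← ZMod.natCast_eq_zero_iff]
  rw [Nat.cast_add, Nat.cast_one, ZMod.natCast_zmod_val, MulEquiv.apply_symm_apply]
  simp

theorem IsPrimitiveRoot.toInteger_sub_one_dvd_map_sub (τ : 𝓞 K →+* 𝓞 K)
    (hτ : τ hζ.toInteger * hζ.toInteger = 1) (x : 𝓞 K) : hζ.toInteger - 1 ∣ τ x - x := by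
  obtain ⟨z, w, hw⟩ := hζ.exists_toInteger_sub_one_dvd_sub_intCast x
  have hx : x = z + (hζ.toInteger - 1) * w := by rw [← hw]; ring
  have h1 : hζ.toInteger - 1 ∣ τ (hζ.toInteger - 1) :=
    ⟨-τ hζ.toInteger, by rw [map_sub, map_one]; linear_combination hτ⟩
  have h2 : τ x - x = τ (hζ.toInteger - 1) * τ w - (hζ.toInteger - 1) * w := by
    conv_lhs => rw [hx, map_add, map_mul, map_intCast]
    ring
  rw [h2]
  exact dvd_sub (h1.mul_right _) (dvd_mul_right _ _)

end Cyclotomic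

theorem IsPrimitiveRoot.exists_associated_toInteger_sub_one_pow {K : Type*} [Field K]
    [NumberField K] {p j : ℕ} [Fact p.Prime] [IsCyclotomicExtension {p ^ (j + 1)} ℚ K] {ζ : K}
    (hζ : IsPrimitiveRoot ζ (p ^ (j + 1))) :
    ∃ e, Associated (p : NumberField.RingOfIntegers K) ((hζ.toInteger - 1) ^ e) := by
  have h := IsCyclotomicExtension.Rat.map_eq_span_zeta_sub_one_pow p j hζ
  rw [Ideal.map_span, Set.image_singleton, Ideal.span_singleton_pow,
    Ideal.span_singleton_eq_span_singleton] at h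
  exact ⟨_, by simpa using h⟩

section GroupRing

open AddMonoidAlgebra

/-- The tautological additive character of `A` with values in the group ring `Λ[A]`. -/
noncomputable def AddMonoidAlgebra.singleAddChar (Λ A : Type*) [CommRing Λ] [AddCommGroup A] :
    AddChar A (AddMonoidAlgebra Λ A) where
  toFun a := single a 1
  map_zero_eq_one' := rfl
  map_add_eq_mul' a b := by simp [single_mul_single]

variable {Λ A : Type*} [CommRing Λ] [AddCommGroup A]

theorem AddMonoidAlgebra.algebraMap_dvd_single {π c : Λ} (h : π ∣ c) (a : A) :
    algebraMap Λ (AddMonoidAlgebra Λ A) π ∣ single a c := by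
  obtain ⟨b, rfl⟩ := h
  exact ⟨single a b, by rw [← Algebra.smul_def, smul_single, smul_eq_mul]⟩

theorem AddMonoidAlgebra.algebraMap_dvd_mapRingHom_sub {π : Λ} (τ : Λ →+* Λ)
    (hτ : ∀ x, π ∣ τ x - x) (x : AddMonoidAlgebra Λ A) :
    algebraMap Λ (AddMonoidAlgebra Λ A) π ∣ mapRingHom A τ x - x := by
  induction x using AddMonoidAlgebra.induction_linear with
  | zero => simp
  | add x y hx hy =>
    rw [map_add, add_sub_add_comm]
    exact dvd_add hx hy
  | single a c =>
    rw [mapRingHom_single, ← single_sub]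
    exact algebraMap_dvd_single (hτ c) a

theorem dvd_pow_prime_pow_sub_of_forall_int {p : ℕ} [Fact p.Prime] {π : Λ} (hp : π ∣ (p : Λ))
    (hπ : ∀ x : Λ, ∃ z : ℤ, π ∣ x - z) (J : ℕ) (x : Λ) : π ∣ x ^ p ^ J - x := by
  obtain ⟨z, hz⟩ := hπ x
  have h1 : π ∣ x ^ p ^ J - (z : Λ) ^ p ^ J := hz.trans (sub_dvd_pow_sub_pow _ _ _)
  have h2 : (p : ℤ) ∣ z ^ p ^ J - z := by
    rw [← ZMod.intCast_zmod_eq_zero_iff_dvd]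
    push_cast
    rw [ZMod.pow_card_pow, sub_self]
  have h3 : π ∣ (z : Λ) ^ p ^ J - z := by
    obtain ⟨w, hw⟩ := h2
    have := congrArg (Int.cast : ℤ → Λ) hw
    push_cast at this
    rw [this]
    exact hp.mul_right _
  have : x ^ p ^ J - x = (x ^ p ^ J - (z : Λ) ^ p ^ J) + ((z : Λ) ^ p ^ J - z) - (x - z) := by
    ring
  rw [this]
  exact dvd_sub (dvd_add h1 h3) hz

theorem AddMonoidAlgebra.algebraMap_dvd_pow_sub {p : ℕ} [Fact p.Prime] {π : Λ}
    (hp : π ∣ (p : Λ)) (hπ : ∀ x : Λ, ∃ z : ℤ, π ∣ x - z) {J : ℕ}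
    (x : AddMonoidAlgebra Λ A) :
    algebraMap Λ (AddMonoidAlgebra Λ A) π ∣ x ^ p ^ J - mapDomain (fun a => p ^ J • a) x := by
  induction x using AddMonoidAlgebra.induction_linear with
  | zero => simp [(Fact.out : p.Prime).ne_zero]
  | add x y hx hy =>
    obtain ⟨w, hw⟩ := exists_add_pow_prime_pow_eq (Fact.out : p.Prime) x y J
    have : (x + y) ^ p ^ J - mapDomain (fun a => p ^ J • a) (x + y)
        = (x ^ p ^ J - mapDomain (fun a => p ^ J • a) x)
          + (y ^ p ^ J - mapDomain (fun a => p ^ J • a) y) + (p : AddMonoidAlgebra Λ A) * (x * y * w)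
        := by
      rw [hw, mapDomain_add]
      ring
    rw [this]
    refine dvd_add (dvd_add hx hy) (Dvd.dvd.mul_right ?_ _)
    have := map_dvd (algebraMap Λ (AddMonoidAlgebra Λ A)) hp
    rwa [map_natCast] at this
  | single a c =>
    rw [mapDomain_single, single_pow, ← single_sub]
    exact algebraMap_dvd_single (dvd_pow_prime_pow_sub_of_forall_int hp hπ J c) _

theorem AddMonoidAlgebra.coeff_natCast_mul (n : ℕ) (x : AddMonoidAlgebra Λ A) (a : A) :
    ((n : AddMonoidAlgebra Λ A) * x).coeff a = n * x.coeff a := by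
  rw [← nsmul_eq_mul, ← nsmul_eq_mul, coeff_smul_apply]

theorem AddMonoidAlgebra.coeff_sum_mul_sum [DecidableEq A] {ι : Type*} (s t : Finset ι)
    (f f' : ι → A) (u u' : ι → Λ) (g : A) :
    ((∑ i ∈ s, single (f i) (u i)) * ∑ i ∈ t, single (f' i) (u' i)).coeff g
      = ∑ x ∈ (s ×ˢ t).filter (fun x => f x.1 + f' x.2 = g), u x.1 * u' x.2 := by
  rw [Finset.sum_mul_sum, ← Finset.sum_product', coeff_sum, Finsupp.finsetSum_apply,
    Finset.sum_filter]
  refine Finset.sum_congr rfl fun x _ => ?_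
  rw [single_mul_single, coeff_single, Finsupp.single_apply]

end GroupRing

section PrimePower

open NumberField AddMonoidAlgebra

theorem AddMonoidAlgebra.mapDomain_id_eq_self {Λ A : Type*} [CommRing Λ] [AddCommGroup A]
    (x : AddMonoidAlgebra Λ A) : mapDomain id x = x := by
  induction x using AddMonoidAlgebra.induction_linear with
  | zero => rw [mapDomain_zero]
  | add x y hx hy => rw [mapDomain_add, hx, hy]
  | single a c => rw [mapDomain_single, id]

/-- Let `n = p ^ (j + 1)`, let `A` have order prime to `p`, and let `β` be a faithful character
of `ℤ/n`. For a relative difference set with `p ^ r` elements in `A × ℤ/n`, the square of the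
`β`-twisted sum, taken in the group ring of `A` with one factor inverted, has a nonzero coefficient
divisible by `p ^ r`. -/
theorem IsAddRDS.exists_coeff_eq {A : Type*} [AddCommGroup A] [Fintype A] [DecidableEq A]
    {p j r l : ℕ} [Fact p.Prime] (hA : p.Coprime (Nat.card A)) (hA1 : 1 < Nat.card A)
    {F : Finset (A × ZMod (p ^ (j + 1)))} (hn : 1 < p ^ (j + 1))
    (h : IsAddRDS (Nat.card A) (p ^ (j + 1)) (p ^ r) l
      (AddMonoidHom.fst A (ZMod (p ^ (j + 1)))).ker (F : Set _))
    {K : Type*} [Field K] [NumberField K] [IsCyclotomicExtension {p ^ (j + 1)} ℚ K] {ζ : K}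
    (hζ : IsPrimitiveRoot ζ (p ^ (j + 1))) (β : AddChar (ZMod (p ^ (j + 1))) (𝓞 K))
    (hβ : β 1 = hζ.toInteger) :
    ∃ (g : A) (E : 𝓞 K), E ≠ 0 ∧
      ∑ x ∈ (F ×ˢ F).filter (fun x => x.1.1 - x.2.1 = g), β (-x.1.2) * β (-x.2.2)
        = (p ^ r : ℕ) * E := by
  have hp : p.Prime := Fact.out
  obtain ⟨τ, hτ⟩ := hζ.exists_ringHom_toInteger_mul_eq_one
  obtain ⟨e, he⟩ := hζ.exists_associated_toInteger_sub_one_pow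
  obtain ⟨π, hπ⟩ : ∃ π, π = hζ.toInteger - 1 := ⟨_, rfl⟩
  have hτβ : ∀ i, τ (β i) = β (-i) := by
    have h1 : ∀ i, τ (β i) * β i = 1 := by
      intro i
      have hi : i = i.val • (1 : ZMod (p ^ (j + 1))) := by simp
      rw [hi, AddChar.map_nsmul_eq_pow, map_pow, ← mul_pow, hβ, hτ, one_pow]
    intro i
    calc τ (β i) = τ (β i) * (β i * β (-i)) := by
          rw [← AddChar.map_add_eq_mul, add_neg_cancel, AddChar.map_zero_eq_one, mul_one]
      _ = β (-i) := by rw [← mul_assoc, h1, one_mul]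
  have hβ1 : β ≠ 1 := by
    intro h1
    have h2 := hζ.toInteger_isPrimitiveRoot.pow_eq_one_iff_dvd 1
    rw [← hβ, h1] at h2
    have := h2.mp (by simp)
    exact hn.ne' (Nat.dvd_one.mp this)
  let S := AddMonoidAlgebra (𝓞 K) A
  let P : S := algebraMap (𝓞 K) S π
  let α : AddChar A S := singleAddChar (𝓞 K) A
  let β' : AddChar (ZMod (p ^ (j + 1))) S := (algebraMap (𝓞 K) S).toMonoidHom.compAddChar β
  have hαβ : ∀ a i, α a * β' i = single a (β i) := fun a i => by
    change single a 1 * algebraMap (𝓞 K) S (β i) = _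
    rw [mul_comm, ← Algebra.smul_def, smul_single, smul_eq_mul, mul_one]
  have hprod : (∑ x ∈ F, single x.1 (β x.2)) * (∑ x ∈ F, single (-x.1) (β (-x.2)))
      = ((p ^ r : ℕ) : S) := by
    have := h.sum_mul_sum α β' (by
      change ∑ b, algebraMap (𝓞 K) S (β b) = 0
      rw [← map_sum, AddChar.sum_eq_zero_of_ne_one hβ1, map_zero])
    simpa only [hαβ] using this
  have hassoc : Associated ((p ^ r : ℕ) : S) (P ^ (e * r)) := by
    have := (he.pow_pow (n := r)).map (algebraMap (𝓞 K) S)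
    rw [← hπ, ← pow_mul, map_pow, map_pow, map_natCast] at this
    rwa [Nat.cast_pow]
  let T : S →+* S := mapRingHom A τ
  have hTA : T (∑ x ∈ F, single x.1 (β x.2)) = ∑ x ∈ F, single x.1 (β (-x.2)) := by
    rw [map_sum]
    exact Finset.sum_congr rfl fun x _ => by rw [mapRingHom_single, hτβ]
  have hπ0 : π ≠ 0 := by
    rw [hπ]
    refine (hζ.zeta_sub_one_prime).ne_zero
  have hreg : IsLeftRegular P := by
    intro x y hxy
    change P * x = P * y at hxy
    rw [← Algebra.smul_def, ← Algebra.smul_def] at hxy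
    exact smul_right_injective S hπ0 hxy
  have hpπ : π ∣ (p : 𝓞 K) := by
    have := IsCyclotomicExtension.Rat.p_mem_span_zeta_sub_one p j hζ
    rwa [Ideal.mem_span_singleton, ← hπ] at this
  obtain ⟨t, ht⟩ : ∃ t, p ^ (Nat.card A).totient = t + 2 := by
    have : 2 ≤ p ^ (Nat.card A).totient := by
      refine hp.two_le.trans (Nat.le_self_pow (Nat.totient_pos.mpr (by omega)).ne' _)
    exact ⟨_, (Nat.sub_add_cancel this).symm⟩
  have hfrob : ∀ x : S, P ∣ x ^ (t + 2) - x := by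
    intro x
    have := algebraMap_dvd_pow_sub (J := (Nat.card A).totient) hpπ
      (fun x => hπ ▸ hζ.exists_toInteger_sub_one_dvd_sub_intCast x) x
    have hid : (fun a : A => p ^ (Nat.card A).totient • a) = id := by
      funext a
      have h1 := Nat.ModEq.pow_totient hA
      have h2 : (p ^ (Nat.card A).totient) • a = 1 • a :=
        (nsmul_eq_nsmul_iff_modEq).mpr (h1.of_dvd (addOrderOf_dvd_natCard a))
      simpa using h2
    rwa [hid, mapDomain_id_eq_self, ht] at this
  have hdvd : ((p ^ r : ℕ) : S) ∣ T (∑ x ∈ F, single x.1 (β x.2))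
      * (∑ x ∈ F, single (-x.1) (β (-x.2))) := by
    rw [hassoc.dvd_iff_dvd_left]
    refine pow_dvd_map_mul_of_pow_dvd_mul T hreg
      (algebraMap_dvd_mapRingHom_sub τ fun x => hπ ▸ hζ.toInteger_sub_one_dvd_map_sub τ hτ x)
      (t := t) ?_ hfrob _ _ _ ?_
    · rw [← ht, Nat.cast_pow]
      have := map_dvd (algebraMap (𝓞 K) S) hpπ
      rw [map_natCast] at this
      exact this.trans (dvd_pow_self _ (Nat.totient_pos.mpr (by omega)).ne')
    · rw [hprod]
      exact hassoc.symm.dvd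
  obtain ⟨E, hE⟩ := hdvd
  have hE0 : E ≠ 0 := by
    rintro rfl
    have h1 := congrArg T hprod
    rw [map_mul, map_natCast] at h1
    have h2 : ((p ^ r : ℕ) : S) * ((p ^ r : ℕ) : S) = 0 := by
      conv_lhs =>
        congr
        · rw [← hprod]
        · rw [← h1]
      linear_combination ((∑ x ∈ F, single x.1 (β x.2))
        * T (∑ x ∈ F, single (-x.1) (β (-x.2)))) * hE
    rw [← Nat.cast_mul, natCast_def] at h2
    have h3 := single_eq_zero.mp h2
    rw [Nat.cast_eq_zero] at h3
    exact (mul_pos (pow_pos hp.pos r) (pow_pos hp.pos r)).ne' h3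
  obtain ⟨g, hg⟩ : ∃ g, E.coeff g ≠ 0 := by
    by_contra! hall
    exact hE0 (AddMonoidAlgebra.ext (Finsupp.ext hall))
  refine ⟨g, E.coeff g, hg, ?_⟩
  have := congrArg (fun x : S => x.coeff g) hE
  simp only [hTA] at this
  rw [coeff_natCast_mul, coeff_sum_mul_sum] at this
  simpa only [sub_eq_add_neg] using this

theorem not_isAddRDS_prime_pow {A : Type*} [AddCommGroup A] [Finite A]
    {p j r l : ℕ} [Fact p.Prime] (hA : p.Coprime (Nat.card A)) (hA1 : 1 < Nat.card A)
    (hn : 2 < p ^ (j + 1)) (hl : l ≠ 0) (R : Set (A × ZMod (p ^ (j + 1)))) :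
    ¬ IsAddRDS (Nat.card A) (p ^ (j + 1)) (p ^ r) l
      (AddMonoidHom.fst A (ZMod (p ^ (j + 1)))).ker R := by
  classical
  intro h
  have := Fintype.ofFinite A
  have hp : p.Prime := Fact.out
  obtain ⟨F, rfl⟩ := (Set.toFinite R).exists_finset_coe
  let K := CyclotomicField (p ^ (j + 1)) ℚ
  have : NeZero (((p ^ (j + 1) : ℕ)) : ℚ) := NeZero.charZero
  have : IsCyclotomicExtension {p ^ (j + 1)} ℚ K := CyclotomicField.isCyclotomicExtension _ _
  have hζ : IsPrimitiveRoot (IsCyclotomicExtension.zeta (p ^ (j + 1)) ℚ K) (p ^ (j + 1)) :=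
    IsCyclotomicExtension.zeta_spec _ _ _
  let β : AddChar (ZMod (p ^ (j + 1))) (𝓞 K) :=
    AddChar.zmodChar _ hζ.toInteger_isPrimitiveRoot.pow_eq_one
  have hβ : β 1 = hζ.toInteger := by
    have : Fact (1 < p ^ (j + 1)) := ⟨by omega⟩
    rw [AddChar.zmodChar_apply, ZMod.val_one, pow_one]
  obtain ⟨g, E, hE, hsum⟩ := h.exists_coeff_eq hA hA1 (by omega) hζ β hβ
  have hF : F.card = p ^ r := by rw [← h.2.2.1, Set.ncard_coe_finset]
  set s := (F ×ˢ F).filter (fun x => x.1.1 - x.2.1 = g) with hs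
  have hmem : ∀ x ∈ s, x.1 ∈ F ∧ x.2 ∈ F ∧ x.1.1 = g + x.2.1 := fun x hx => by
    rw [hs, Finset.mem_filter, Finset.mem_product] at hx
    exact ⟨hx.1.1, hx.1.2, sub_eq_iff_eq_add.mp hx.2⟩
  have hinj2 : Set.InjOn (fun x : (A × ZMod (p ^ (j + 1))) × (A × ZMod (p ^ (j + 1))) => x.2) s := by
    intro x hx y hy hxy
    obtain ⟨h1, h2, h3⟩ := hmem x hx
    obtain ⟨h4, h5, h6⟩ := hmem y hy
    refine Prod.ext (h.eq_of_fst_eq h1 h4 ?_) hxy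
    rw [h3, h6, show x.2 = y.2 from hxy]
  have hinj1 : Set.InjOn (fun x : (A × ZMod (p ^ (j + 1))) × (A × ZMod (p ^ (j + 1))) => x.1) s := by
    intro x hx y hy hxy
    obtain ⟨h1, h2, h3⟩ := hmem x hx
    obtain ⟨h4, h5, h6⟩ := hmem y hy
    refine Prod.ext hxy (h.eq_of_fst_eq h2 h5 ?_)
    rw [show x.1 = y.1 from hxy, h6] at h3
    exact (add_left_cancel h3).symm
  have hcard : s.card ≤ p ^ r := by
    rw [← hF]
    exact Finset.card_le_card_of_injOn _ (fun x hx => (hmem x hx).2.1) hinj2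
  obtain ⟨hcard', hu⟩ := NumberField.eq_of_sum_rootsOfUnity_eq (K := K) (n := p ^ (j + 1))
    (pow_pos hp.pos _).ne' (s := s) (u := fun x => β (-x.1.2) * β (-x.2.2))
    (fun x _ => by
      rw [← AddChar.map_add_eq_mul, ← AddChar.map_nsmul_eq_pow, ZModModule.char_nsmul_eq_zero,
        AddChar.map_zero_eq_one])
    hcard (pow_pos hp.pos _).ne' hE hsum
  have him2 : s.image (fun x => x.2) = F :=
    Finset.eq_of_subset_of_card_le (Finset.image_subset_iff.mpr fun x hx => (hmem x hx).2.1)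
      (by rw [Finset.card_image_of_injOn hinj2, hcard', hF])
  have him1 : s.image (fun x => x.1) = F :=
    Finset.eq_of_subset_of_card_le (Finset.image_subset_iff.mpr fun x hx => (hmem x hx).1)
      (by rw [Finset.card_image_of_injOn hinj1, hcard', hF])
  have hg : g = 0 := by
    have h1 : ∑ x ∈ s, x.1.1 = ∑ x ∈ F, x.1 := by
      conv_rhs => rw [← him1]
      rw [Finset.sum_image hinj1]
    have h2 : ∑ x ∈ s, x.2.1 = ∑ x ∈ F, x.1 := by
      conv_rhs => rw [← him2]
      rw [Finset.sum_image hinj2]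
    have h3 : p ^ r • g = 0 := by
      have h4 : ∑ x ∈ s, (x.1.1 - x.2.1) = 0 := by rw [Finset.sum_sub_distrib, h1, h2, sub_self]
      rwa [Finset.sum_congr rfl (g := fun _ => g)
        (fun x hx => (Finset.mem_filter.mp hx).2), Finset.sum_const, hcard'] at h4
    refine AddMonoid.addOrderOf_eq_one_iff.mp
      (Nat.eq_one_of_dvd_coprimes (hA.pow_left r) (addOrderOf_dvd_of_nsmul_eq_zero h3)
        (addOrderOf_dvd_natCard g))
  have hsq : ∀ x ∈ F, β (-x.2) * β (-x.2) = E := by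
    intro x hx
    exact hu (x, x) (by rw [hs, Finset.mem_filter]; simp [hx, hg])
  have : Nontrivial A := Finite.one_lt_card_iff_nontrivial.mp hA1
  obtain ⟨a, ha⟩ := exists_ne (0 : A)
  obtain ⟨x, hx, y, hy, hxy⟩ := h.exists_sub_eq hl (g := (a, 1)) ha
  have h2 : β 2 = 1 := by
    have hxy2 : x.2 = y.2 + 1 := by
      have := congrArg Prod.snd hxy
      rw [Prod.snd_sub, sub_eq_iff_eq_add] at this
      exact this.trans (add_comm (1 : ZMod (p ^ (j + 1))) y.2)
    have h3 := (hsq x hx).trans (hsq y hy).symm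
    rw [← AddChar.map_add_eq_mul, ← AddChar.map_add_eq_mul, hxy2] at h3
    calc β 2 = β (-y.2 + -y.2) * β (y.2 + y.2 + 2) := by
          rw [← AddChar.map_add_eq_mul]; congr 1; ring
      _ = 1 := by
          rw [← h3, ← AddChar.map_add_eq_mul, ← AddChar.map_zero_eq_one β]; congr 1; ring
  have h4 : hζ.toInteger ^ 2 = 1 := by
    rw [← hβ, ← AddChar.map_nsmul_eq_pow, nsmul_eq_mul, mul_one, ← h2]
    rfl
  rw [hζ.toInteger_isPrimitiveRoot.pow_eq_one_iff_dvd] at h4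
  exact absurd (Nat.le_of_dvd two_pos h4) (by omega)

end PrimePower

section SelfConjugate

open AddMonoidAlgebra

variable {A : Type*} [AddCommGroup A] {p J : ℕ} [Fact p.Prime]

theorem AddMonoidAlgebra.natCast_dvd_of_dvd_mul_neg (hJ : J ≠ 0) (hA : ∀ a : A, p ^ J • a = -a)
    {x : AddMonoidAlgebra ℤ A}
    (h : (p : AddMonoidAlgebra ℤ A) ∣ x * mapDomain (fun a => -a) x) :
    (p : AddMonoidAlgebra ℤ A) ∣ x := by
  have hp : p.Prime := Fact.out
  have key : ∀ (J : ℕ) (x : AddMonoidAlgebra ℤ A),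
      (p : AddMonoidAlgebra ℤ A) ∣ x ^ p ^ J - mapDomain (fun a => p ^ J • a) x := by
    intro J x
    have := algebraMap_dvd_pow_sub (p := p) (π := (p : ℤ)) (by simp) (fun x => ⟨x, by simp⟩)
      (J := J) x
    rwa [map_natCast] at this
  have h1 := key J x
  simp_rw [hA] at h1
  have h2 := key (2 * J) x
  have hid : (fun a : A => p ^ (2 * J) • a) = id := by
    funext a
    rw [two_mul, pow_add, mul_nsmul, hA, hA, neg_neg, id]
  rw [hid, mapDomain_id_eq_self] at h2
  have h3 : (p : AddMonoidAlgebra ℤ A) ∣ x ^ (p ^ J + 1) := by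
    have : x ^ (p ^ J + 1) = x * (x ^ p ^ J - mapDomain (fun a => -a) x)
        + x * mapDomain (fun a => -a) x := by ring
    rw [this]
    exact dvd_add (h1.mul_left _) h
  have h4 : p ^ J + 1 ≤ p ^ (2 * J) := by
    have : 2 ≤ p ^ J := hp.two_le.trans (Nat.le_self_pow hJ p)
    rw [two_mul, pow_add]
    nlinarith
  exact (dvd_sub_right (h3.trans (pow_dvd_pow x h4))).mp h2

theorem AddMonoidAlgebra.exists_pow_dvd_of_mul_neg_eq_pow (hJ : J ≠ 0)
    (hA : ∀ a : A, p ^ J • a = -a) (r : ℕ) (x : AddMonoidAlgebra ℤ A)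
    (h : x * mapDomain (fun a => -a) x = ((p ^ r : ℕ) : AddMonoidAlgebra ℤ A)) :
    ∃ i, r = 2 * i ∧ ((p ^ i : ℕ) : AddMonoidAlgebra ℤ A) ∣ x := by
  have hp : p.Prime := Fact.out
  have hcancel : ∀ y z : AddMonoidAlgebra ℤ A, (p : AddMonoidAlgebra ℤ A) * y = p * z → y = z := by
    intro y z hyz
    rw [← nsmul_eq_mul, ← nsmul_eq_mul] at hyz
    exact smul_right_injective _ hp.ne_zero hyz
  induction r using Nat.strong_induction_on generalizing x with
  | _ r ih =>
    obtain _ | r := r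
    · exact ⟨0, rfl, by simp⟩
    obtain ⟨y, rfl⟩ := natCast_dvd_of_dvd_mul_neg (p := p) hJ hA (x := x)
      (by rw [h, pow_succ, Nat.cast_mul]; exact dvd_mul_left _ _)
    have hneg : mapDomain (fun a : A => -a) ((p : AddMonoidAlgebra ℤ A) * y)
        = p * mapDomain (fun a => -a) y := by
      rw [← nsmul_eq_mul, ← nsmul_eq_mul]
      exact map_nsmul (mapDomainRingHom ℤ (-AddMonoidHom.id A)) p y
    have h1 : (p : AddMonoidAlgebra ℤ A) * (y * mapDomain (fun a => -a) y) = ((p ^ r : ℕ) : _) := by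
      apply hcancel
      rw [hneg, pow_succ, Nat.cast_mul] at h
      linear_combination h
    obtain _ | r := r
    · exfalso
      have := congrArg (fun z => z.coeff (0 : A)) h1
      simp only [coeff_natCast_mul, coeff_natCast, Finsupp.single_eq_same, pow_zero] at this
      have h2 : (p : ℤ) ∣ 1 := ⟨_, this.symm⟩
      exact hp.one_lt.ne' (by exact_mod_cast Int.eq_one_of_dvd_one (by positivity) h2)
    · obtain ⟨i, hi, z, rfl⟩ := ih r (by omega) y (hcancel _ _ (by
        rw [h1, pow_succ, Nat.cast_mul, mul_comm]))
      exact ⟨i + 1, by omega, z, by rw [pow_succ, Nat.cast_mul]; ring⟩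

theorem IsAddRDS.exists_pow_le_card_ker [Finite A] {A' : Type*} [AddCommGroup A'] [Finite A']
    (hJ : J ≠ 0) (hA' : ∀ a : A', p ^ J • a = -a) (φ : A →+ A') {m r l : ℕ} {R : Set (A × ZMod 2)}
    (h : IsAddRDS m 2 (p ^ r) l (AddMonoidHom.fst A (ZMod 2)).ker R) :
    ∃ i, r = 2 * i ∧ p ^ i ≤ Nat.card φ.ker := by
  classical
  have hp : p.Prime := Fact.out
  have := Fintype.ofFinite A
  obtain ⟨F, rfl⟩ := (Set.toFinite R).exists_finset_coe
  let S := AddMonoidAlgebra ℤ A'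
  let β : AddChar (ZMod 2) ℤ := AddChar.zmodChar 2 (ζ := -1) (by norm_num)
  have hβ0 : ∑ b, β b = 0 := by decide
  have hβ1 : ∀ b, |β b| = 1 := by decide
  have hβn : ∀ b, β (-b) = β b := by decide
  let α : AddChar A S := (singleAddChar ℤ A').compAddMonoidHom φ
  let β' : AddChar (ZMod 2) S := (algebraMap ℤ S).toMonoidHom.compAddChar β
  have hαβ : ∀ a i, α a * β' i = single (φ a) (β i) := fun a i => by
    change single (φ a) 1 * algebraMap ℤ S (β i) = _
    rw [mul_comm, ← Algebra.smul_def, smul_single, smul_eq_mul, mul_one]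
  have hprod := h.sum_mul_sum α β' (by
      change ∑ b, algebraMap ℤ S (β b) = 0
      rw [← map_sum, hβ0, map_zero])
  simp only [hαβ] at hprod
  obtain ⟨i, hi, y, hy⟩ := exists_pow_dvd_of_mul_neg_eq_pow (p := p) hJ hA' r
    (∑ x ∈ F, single (φ x.1) (β x.2)) (by
      rw [← hprod]
      congr 1
      refine (map_sum (mapDomainRingHom ℤ (-AddMonoidHom.id A')) _ F).trans ?_
      refine Finset.sum_congr rfl fun x _ => ?_
      rw [map_neg, hβn]
      exact mapDomain_single)
  refine ⟨i, hi, ?_⟩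
  have hy0 : y ≠ 0 := by
    rintro rfl
    rw [hy, mul_zero, zero_mul] at hprod
    have := congrArg (fun z : S => z.coeff (0 : A')) hprod
    simp only [S, coeff_zero, coeff_natCast, Finsupp.zero_apply, Finsupp.single_eq_same] at this
    exact (pow_pos hp.pos r).ne (by exact_mod_cast this)
  obtain ⟨g, hg⟩ : ∃ g, y.coeff g ≠ 0 := by
    by_contra! hall
    exact hy0 (AddMonoidAlgebra.ext (Finsupp.ext hall))
  have hc := congrArg (fun z : S => z.coeff g) hy
  simp only [coeff_natCast_mul, coeff_sum, Finsupp.finsetSum_apply, coeff_single,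
    Finsupp.single_apply] at hc
  rw [← Finset.sum_filter] at hc
  have hle : ((p ^ i : ℕ) : ℤ) ≤ (F.filter (fun x => φ x.1 = g)).card := by
    calc ((p ^ i : ℕ) : ℤ) ≤ ((p ^ i : ℕ) : ℤ) * |y.coeff g| :=
          le_mul_of_one_le_right (by positivity) (Int.one_le_abs hg)
      _ = |((p ^ i : ℕ) : ℤ) * y.coeff g| := by rw [abs_mul, Nat.abs_cast]
      _ ≤ ∑ x ∈ F.filter (fun x => φ x.1 = g), |β x.2| := by
          rw [← hc]; exact Finset.abs_sum_le_sum_abs _ _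
      _ = _ := by simp [hβ1]
  have hle' : p ^ i ≤ (F.filter (fun x => φ x.1 = g)).card := by exact_mod_cast hle
  refine hle'.trans ?_
  obtain ⟨x₀, hx₀⟩ : (F.filter (fun x => φ x.1 = g)).Nonempty :=
    Finset.card_pos.mp ((pow_pos hp.pos i).trans_le hle')
  rw [← Fintype.card_coe, ← Nat.card_eq_fintype_card]
  refine Nat.card_le_card_of_injective (fun x => ⟨x.1.1 - x₀.1, ?_⟩) ?_
  · rw [AddMonoidHom.mem_ker, map_sub, (Finset.mem_filter.mp x.2).2, (Finset.mem_filter.mp hx₀).2,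
      sub_self]
  · intro x y hxy
    have := sub_left_injective (congrArg Subtype.val hxy)
    exact Subtype.ext (h.eq_of_fst_eq (Finset.mem_filter.mp x.2).1 (Finset.mem_filter.mp y.2).1 this)

end SelfConjugate

section Necessity

theorem singer_card_mul {q d : ℕ} : (q ^ d - 1) / (q - 1) * (q - 1) = q ^ d - 1 :=
  Nat.div_mul_cancel (Nat.sub_one_dvd_pow_sub_one q d)

theorem singer_card_coprime {p f d : ℕ} (hp : p.Prime) (hf : f ≠ 0) (hd : 2 ≤ d) :
    p.Coprime (((p ^ f) ^ d - 1) / (p ^ f - 1)) := by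
  rw [hp.coprime_iff_not_dvd]
  intro h
  have h1 : p ∣ (p ^ f) ^ d - 1 := singer_card_mul ▸ h.mul_right _
  have h2 : p ∣ (p ^ f) ^ d := dvd_pow (dvd_pow_self p hf) (by omega)
  have h3 : 0 < (p ^ f) ^ d := pow_pos (pow_pos hp.pos _) _
  have := (Nat.dvd_sub_iff_right h3 h2).mp h1
  exact hp.one_lt.ne' (Nat.dvd_one.mp this)

theorem one_lt_singer_card {q d : ℕ} (hq : 1 < q) (hd : 2 ≤ d) : 1 < (q ^ d - 1) / (q - 1) := by
  rw [← Nat.geomSum_eq hq]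
  obtain ⟨d, rfl⟩ := Nat.exists_eq_add_of_le' hd
  rw [Finset.sum_range_succ', pow_zero]
  have : 0 < ∑ k ∈ Finset.range (d + 1), q ^ (k + 1) :=
    Finset.sum_pos (fun _ _ => by positivity) (by simp)
  omega

theorem IsCyclicAddRDS.prime_pow_le_two {m n r l p j : ℕ} (hp : p.Prime)
    (h : IsCyclicAddRDS m n (p ^ r) l) (hpm : p.Coprime m) (hm : 1 < m) (hn : n ≠ 0) (hl : l ≠ 0)
    (hj : p ^ (j + 1) ∣ n) : p ^ (j + 1) ≤ 2 := by
  by_contra! hlt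
  have : Fact p.Prime := ⟨hp⟩
  obtain ⟨c, rfl⟩ := hj
  rw [mul_comm] at h hn
  obtain ⟨R, hR⟩ := h.exists_prod (mul_ne_zero (by omega) hn) (hpm.pow_left _).symm
  have : NeZero m := ⟨by omega⟩
  refine not_isAddRDS_prime_pow (A := ZMod m) (p := p) (j := j) (r := r) (l := c * l)
    (by simpa using hpm) (by simpa using hm) hlt (mul_ne_zero (left_ne_zero_of_mul hn) hl) R ?_
  simpa using hR

theorem IsCyclicAddRDS.not_two_dvd {f k n l : ℕ} (hf : f ≠ 0) (hk : k ≠ 0)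
    (h : IsCyclicAddRDS (((2 ^ f) ^ (2 * k) - 1) / (2 ^ f - 1)) n ((2 ^ f) ^ (2 * k - 1)) l)
    (hn : n ≠ 0) : ¬ 2 ∣ n := by
  rintro ⟨c, rfl⟩
  have : Fact (Nat.Prime 2) := ⟨Nat.prime_two⟩
  have hq : 1 < 2 ^ f := Nat.one_lt_two_pow hf
  have hco := singer_card_coprime (d := 2 * k) Nat.prime_two hf (by omega)
  have hv := one_lt_singer_card (d := 2 * k) hq (by omega)
  have hmul := singer_card_mul (q := 2 ^ f) (d := k)
  have hvU : ((2 ^ f) ^ (2 * k) - 1) / (2 ^ f - 1)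
      = ((2 ^ f) ^ k + 1) * (((2 ^ f) ^ k - 1) / (2 ^ f - 1)) := by
    rw [← Nat.mul_div_assoc _ (Nat.sub_one_dvd_pow_sub_one _ _)]
    congr 1
    rw [← Nat.sq_sub_sq, ← pow_mul _ k 2, mul_comm k, one_pow]
  generalize ((2 ^ f) ^ k - 1) / (2 ^ f - 1) = w at hvU hmul
  generalize ((2 ^ f) ^ (2 * k) - 1) / (2 ^ f - 1) = v at h hco hv hvU
  subst hvU
  rw [mul_comm 2 c] at h hn
  obtain ⟨R, hR⟩ := h.exists_prod (mul_ne_zero (by omega) hn) hco.symm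
  have : NeZero (((2 ^ f) ^ k + 1) * w) := ⟨by omega⟩
  rw [← pow_mul 2 f (2 * k - 1)] at hR
  let φ : ZMod (((2 ^ f) ^ k + 1) * w) →+ ZMod ((2 ^ f) ^ k + 1) :=
    (ZMod.castHom (dvd_mul_right _ w) (ZMod ((2 ^ f) ^ k + 1))).toAddMonoidHom
  have hφ : Function.Surjective φ := ZMod.castHom_surjective (dvd_mul_right _ w)
  obtain ⟨i, hi, hle⟩ := hR.exists_pow_le_card_ker (p := 2) (J := f * k) (mul_ne_zero hf hk)
    (fun a => by
      rw [eq_neg_iff_add_eq_zero, ← succ_nsmul, pow_mul, nsmul_eq_mul, ZMod.natCast_self,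
        zero_mul]) φ
  have hcard : Nat.card φ.ker = w := by
    have h1 := AddSubgroup.card_mul_index φ.ker
    rw [AddSubgroup.index_ker, AddMonoidHom.range_eq_top.mpr hφ, AddSubgroup.card_top,
      Nat.card_zmod, Nat.card_zmod, mul_comm] at h1
    exact Nat.eq_of_mul_eq_mul_left (by omega) h1
  rw [hcard] at hle
  have hf2 : 2 ≤ f := by
    by_contra!
    have : f = 1 := by omega
    subst this
    omega
  have hq4 : 4 ≤ 2 ^ f := (by norm_num : 4 = 2 ^ 2) ▸ Nat.pow_le_pow_right two_pos hf2
  have hsq : 2 ^ i * 2 ^ i * 2 ^ f = (2 ^ f) ^ k * (2 ^ f) ^ k := by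
    rw [← pow_add, ← two_mul, ← hi, ← pow_mul, ← pow_add, ← pow_add]
    congr 1
    have : 1 ≤ 2 * k := by omega
    zify [this]
    ring
  have hlt : 2 ^ i * (2 ^ f - 1) < (2 ^ f) ^ k := by
    have : 0 < (2 ^ f) ^ k := by positivity
    calc 2 ^ i * (2 ^ f - 1) ≤ w * (2 ^ f - 1) := Nat.mul_le_mul_right _ hle
      _ < _ := by omega
  generalize (2 ^ f) ^ k = Q at hsq hlt
  generalize 2 ^ f = q at hsq hlt hq4
  obtain ⟨s, rfl⟩ := Nat.exists_eq_add_of_le' hq4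
  have hi0 : 0 < 2 ^ i := by positivity
  generalize 2 ^ i = x at hsq hlt hi0
  have h2 := Nat.mul_self_lt_mul_self hlt
  rw [← hsq] at h2
  have h3 : s + 4 - 1 = s + 3 := by omega
  rw [h3] at h2
  nlinarith [mul_pos hi0 hi0]

theorem dvd_of_isCyclicAddRDS {p f d n : ℕ} (hp : p.Prime) (hf : f ≠ 0) (hd : 2 ≤ d) (hn : 0 < n)
    (hdvd : n ∣ (p ^ f) ^ (d - 2) * (p ^ f - 1))
    (h : IsCyclicAddRDS (((p ^ f) ^ d - 1) / (p ^ f - 1)) n ((p ^ f) ^ (d - 1))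
      ((p ^ f) ^ (d - 2) * (p ^ f - 1) / n)) :
    (p ≠ 2 ∨ Even d → n ∣ p ^ f - 1) ∧ n ∣ 2 * (p ^ f - 1) := by
  have hq : 1 < p ^ f := Nat.one_lt_pow hf hp.one_lt
  have hpos : 0 < (p ^ f) ^ (d - 2) * (p ^ f - 1) := by
    have : 0 < p ^ f - 1 := by omega
    positivity
  have hl : (p ^ f) ^ (d - 2) * (p ^ f - 1) / n ≠ 0 :=
    (Nat.div_pos (Nat.le_of_dvd hpos hdvd) hn).ne'
  have hco : ∀ n', p.Coprime n' → n' ∣ n → n' ∣ p ^ f - 1 := fun n' h1 h2 =>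
    (((h1.pow_left f).pow_left (d - 2)).symm).dvd_of_dvd_mul_left (h2.trans hdvd)
  have hA : ∀ j, p ^ (j + 1) ∣ n → p ^ (j + 1) ≤ 2 := fun j hj => by
    have h' := h
    rw [← pow_mul p f (d - 1)] at h'
    exact h'.prime_pow_le_two hp (singer_card_coprime hp hf hd) (one_lt_singer_card hq hd) hn.ne'
      hl hj
  have h1 : p ≠ 2 ∨ Even d → n ∣ p ^ f - 1 := by
    intro hcase
    refine hco n ((hp.coprime_iff_not_dvd).mpr fun hpn => ?_) dvd_rfl
    have hp2 : p = 2 := le_antisymm (by simpa using hA 0 (by simpa using hpn)) hp.two_le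
    obtain ⟨k, rfl⟩ := (hcase.resolve_left (not_not.mpr hp2))
    subst hp2
    rw [← two_mul] at h
    exact h.not_two_dvd hf (by omega) hn.ne' hpn
  refine ⟨h1, ?_⟩
  by_cases hp2 : p = 2
  · subst hp2
    by_cases h2 : 2 ∣ n
    · obtain ⟨n', rfl⟩ := h2
      refine mul_dvd_mul_left 2 (hco n' ((hp.coprime_iff_not_dvd).mpr fun h3 => ?_)
        (dvd_mul_left _ _))
      have := hA 1 (mul_dvd_mul_left 2 (by simpa using h3))
      omega
    · exact (hco n ((hp.coprime_iff_not_dvd).mpr h2) dvd_rfl).mul_left 2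
  · exact (h1 (Or.inl hp2)).mul_left 2

end Necessity

section TraceOne

variable {K L : Type*} [Field K] [Field L] [Algebra K L]

theorem LinearMap.ncard_fiber_mul_card {V : Type*} [AddCommGroup V] [Module K V] (f : L →ₗ[K] V)
    (hf : Function.Surjective f) (y : V) : {x | f x = y}.ncard * Nat.card V = Nat.card L := by
  have h1 := AddSubgroup.card_mul_index f.toAddMonoidHom.ker
  rw [AddSubgroup.index_ker, AddMonoidHom.range_eq_top.mpr hf, AddSubgroup.card_top] at h1
  obtain ⟨x₀, rfl⟩ := hf y
  rw [← h1]
  congr 1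
  refine Nat.card_congr ⟨fun x => ⟨x.1 - x₀, ?_⟩, fun x => ⟨x.1 + x₀, ?_⟩, fun x => ?_, fun x => ?_⟩
  · change f (x.1 - x₀) = 0
    rw [map_sub, show f x.1 = f x₀ from x.2, sub_self]
  · change f (x.1 + x₀) = f x₀
    rw [map_add, show f x.1 = 0 from x.2, zero_add]
  · simp
  · simp

theorem Algebra.eq_zero_of_trace_mul_eq_zero [Finite L] {c : L}
    (h : ∀ x, Algebra.trace K L (c * x) = 0) : c = 0 := by
  by_contra hc
  have : Finite K := Finite.of_injective _ (algebraMap K L).injective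
  refine Algebra.trace_ne_zero K L (LinearMap.ext fun y => ?_)
  simpa [hc] using h (c⁻¹ * y)

theorem Algebra.ncard_trace_eq_one [Finite L] :
    {x | Algebra.trace K L x = 1}.ncard * Nat.card K = Nat.card L := by
  have : Finite K := Finite.of_injective _ (algebraMap K L).injective
  exact LinearMap.ncard_fiber_mul_card _ (Algebra.trace_surjective K L) 1

theorem Algebra.ncard_trace_eq_one_and [Finite L] {g : L} (hg : ∀ a : K, algebraMap K L a ≠ g) :
    {x | Algebra.trace K L (g * x) = 1 ∧ Algebra.trace K L x = 1}.ncard * (Nat.card K) ^ 2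
      = Nat.card L := by
  have : Finite K := Finite.of_injective _ (algebraMap K L).injective
  let f : L →ₗ[K] K × K :=
    ((Algebra.trace K L).comp (LinearMap.mulLeft K g)).prod (Algebra.trace K L)
  have hf : Function.Surjective f := by
    rw [← LinearMap.range_eq_top]
    by_contra hne
    obtain ⟨φ, hφ0, hφ⟩ := Submodule.exists_le_ker_of_lt_top _ (lt_top_iff_ne_top.mpr hne)
    have hφab : ∀ a b, φ (a, b) = a * φ (1, 0) + b * φ (0, 1) := by
      intro a b
      rw [← smul_eq_mul, ← smul_eq_mul, ← map_smul, ← map_smul, ← map_add]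
      simp
    have hc : algebraMap K L (φ (1, 0)) * g + algebraMap K L (φ (0, 1)) = 0 := by
      refine Algebra.eq_zero_of_trace_mul_eq_zero (K := K) fun x => ?_
      have h1 : φ (f x) = 0 := hφ ⟨x, rfl⟩
      change φ (Algebra.trace K L (g * x), Algebra.trace K L x) = 0 at h1
      rw [hφab] at h1
      rw [add_mul, mul_assoc, ← Algebra.smul_def, ← Algebra.smul_def, map_add, map_smul, map_smul,
        smul_eq_mul, smul_eq_mul]
      linear_combination h1
    by_cases h1 : φ (1, 0) = 0
    · rw [h1, map_zero, zero_mul, zero_add, map_eq_zero] at hc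
      exact hφ0 (LinearMap.ext fun x => by rw [← Prod.mk.eta (p := x), hφab, h1, hc]; simp)
    · refine hg (-φ (0, 1) / φ (1, 0)) ?_
      rw [map_div₀, map_neg, div_eq_iff (by simpa using h1)]
      linear_combination -hc
  have := LinearMap.ncard_fiber_mul_card f hf (1, 1)
  rw [Nat.card_prod, ← sq] at this
  rw [← this]
  congr 2
  ext x
  simp [f]

/-- The group of nonzero elements of `K`, as a subgroup of the multiplicative group of `L`. -/
def unitsAddSubgroup (K L : Type*) [Field K] [Field L] [Algebra K L] :
    AddSubgroup (Additive Lˣ) :=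
  (Units.map (algebraMap K L : K →* L)).toAdditive.range

theorem mem_unitsAddSubgroup_iff {g : Additive Lˣ} :
    g ∈ unitsAddSubgroup K L ↔ ∃ a : K, algebraMap K L a = (g.toMul : L) := by
  constructor
  · rintro ⟨a, rfl⟩
    exact ⟨(a.toMul : K), rfl⟩
  · rintro ⟨a, ha⟩
    have ha0 : a ≠ 0 := by
      rintro rfl
      rw [map_zero] at ha
      exact g.toMul.ne_zero ha.symm
    exact ⟨Additive.ofMul (Units.mk0 a ha0), Units.ext ha⟩

theorem card_unitsAddSubgroup [Finite L] : Nat.card (unitsAddSubgroup K L) = Nat.card K - 1 := by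
  have : Finite K := Finite.of_injective _ (algebraMap K L).injective
  rw [← Nat.card_units, unitsAddSubgroup]
  refine (Nat.card_congr (AddMonoidHom.ofInjective
    (f := (Units.map (algebraMap K L : K →* L)).toAdditive) ?_).toEquiv).symm
  exact Units.map_injective (algebraMap K L).injective

theorem ncard_units_sub_eq {X Y : Set L} (hX : ∀ x ∈ X, x ≠ 0) (g : Lˣ) :
    {p : Additive Lˣ × Additive Lˣ | (p.1.toMul : L) ∈ X ∧ (p.2.toMul : L) ∈ Y ∧
      p.1 - p.2 = Additive.ofMul g}.ncard = {x : L | (g : L) * x ∈ X ∧ x ∈ Y}.ncard := by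
  refine Set.ncard_congr (fun p _ => (p.2.toMul : L)) ?_ ?_ ?_
  · rintro ⟨a, b⟩ ⟨ha, hb, hab⟩
    refine ⟨?_, hb⟩
    rw [sub_eq_iff_eq_add] at hab
    have : a.toMul = g * b.toMul := congrArg Additive.toMul hab
    change (a.toMul : L) ∈ X at ha
    rwa [this] at ha
  · rintro ⟨a, b⟩ ⟨a', b'⟩ ⟨ha, hb, hab⟩ ⟨ha', hb', hab'⟩ h
    have h1 : b = b' := Units.ext h
    rw [sub_eq_iff_eq_add] at hab hab'
    change a = _ + b at hab
    change a' = _ + b' at hab'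
    rw [hab, hab', h1]
  · rintro x ⟨h1, h2⟩
    have hx : x ≠ 0 := right_ne_zero_of_mul (hX _ h1)
    exact ⟨(Additive.ofMul (g * Units.mk0 x hx), Additive.ofMul (Units.mk0 x hx)),
      ⟨h1, h2, by rw [ofMul_mul, add_sub_cancel_right]⟩, rfl⟩

theorem isAddRDS_trace_eq_one [Finite L] {q d : ℕ} (hq : Nat.card K = q) (hd : Module.finrank K L = d)
    (hd2 : 2 ≤ d) :
    IsAddRDS ((q ^ d - 1) / (q - 1)) (q - 1) (q ^ (d - 1)) (q ^ (d - 2)) (unitsAddSubgroup K L)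
      {x : Additive Lˣ | Algebra.trace K L (x.toMul : L) = 1} := by
  have : Finite K := Finite.of_injective _ (algebraMap K L).injective
  have hL : Nat.card L = q ^ d := by rw [← hq, ← hd, Module.natCard_eq_pow_finrank (K := K)]
  have hqpos : 0 < q := hq ▸ Nat.card_pos
  have hX : ∀ x ∈ {x : L | Algebra.trace K L x = 1}, x ≠ 0 := by
    rintro x hx rfl
    simp at hx
  refine ⟨?_, ?_, ?_, ?_, ?_⟩
  · rw [singer_card_mul, ← hL, ← Nat.card_units]
    rfl
  · rw [card_unitsAddSubgroup, hq]
  · have h1 := Algebra.ncard_trace_eq_one (K := K) (L := L)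
    rw [hq, hL] at h1
    have h2 : q ^ d = q ^ (d - 1) * q := by rw [← pow_succ]; congr 1; omega
    rw [← Nat.eq_of_mul_eq_mul_right hqpos (h1.trans h2)]
    refine Set.ncard_congr (fun x _ => (x.toMul : L)) (fun x hx => hx)
      (fun x y _ _ h => Units.ext h) fun x hx => ⟨Additive.ofMul (Units.mk0 x (hX x hx)), hx, rfl⟩
  · intro g hg
    rw [mem_unitsAddSubgroup_iff] at hg
    push Not at hg
    have h1 := Algebra.ncard_trace_eq_one_and hg
    rw [hq, hL] at h1
    have h2 : q ^ d = q ^ (d - 2) * q ^ 2 := by rw [← pow_add]; congr 1; omega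
    rw [← Nat.eq_of_mul_eq_mul_right (pow_pos hqpos 2) (h1.trans h2)]
    exact ncard_units_sub_eq (Y := {x : L | Algebra.trace K L x = 1}) hX g.toMul
  · intro g hg hg0
    rw [mem_unitsAddSubgroup_iff] at hg
    obtain ⟨a, ha⟩ := hg
    refine (ncard_units_sub_eq (Y := {x : L | Algebra.trace K L x = 1}) hX g.toMul).trans ?_
    rw [Set.ncard_eq_zero (Set.toFinite _), Set.eq_empty_iff_forall_notMem]
    rintro x ⟨h1, h2⟩
    change Algebra.trace K L (_ * x) = 1 at h1
    change Algebra.trace K L x = 1 at h2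
    rw [← ha, ← Algebra.smul_def, map_smul, h2, smul_eq_mul, mul_one] at h1
    rw [h1, map_one] at ha
    exact hg0 (Units.ext ha.symm)

end TraceOne

theorem isCyclicAddRDS_of_dvd {p f d n : ℕ} (hp : p.Prime) (hf : f ≠ 0) (hd : 2 ≤ d) (hn : 0 < n)
    (hdvd : n ∣ p ^ f - 1) :
    IsCyclicAddRDS (((p ^ f) ^ d - 1) / (p ^ f - 1)) n ((p ^ f) ^ (d - 1))
      ((p ^ f) ^ (d - 2) * (p ^ f - 1) / n) := by
  have : Fact p.Prime := ⟨hp⟩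
  have : NeZero d := ⟨by omega⟩
  have hK : Nat.card (GaloisField p f) = p ^ f := GaloisField.card p f hf
  have h := isAddRDS_trace_eq_one (K := GaloisField p f)
    (L := FiniteField.Extension (GaloisField p f) p d) hK
    (FiniteField.finrank_extension _ _ _) hd
  obtain ⟨c, hc⟩ := hdvd
  generalize ((p ^ f) ^ d - 1) / (p ^ f - 1) = v at h ⊢
  rw [mul_comm] at hc
  rw [hc] at h ⊢
  rw [← mul_assoc, Nat.mul_div_cancel _ hn, mul_comm _ c]
  exact h.isCyclicAddRDS

section Bent

variable {K L : Type*} [Field K] [Field L] [Algebra K L]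

/-- The nontrivial additive character of `ℤ/2`, with integer values. -/
def signAddChar : AddChar (ZMod 2) ℤ := AddChar.zmodChar 2 (ζ := -1) (by norm_num)

theorem signAddChar_zero : signAddChar 0 = 1 := AddChar.map_zero_eq_one _

theorem signAddChar_one : signAddChar 1 = -1 := by decide

theorem signAddChar_injective : Function.Injective signAddChar := by decide

theorem signAddChar_ne_zero (i : ZMod 2) : signAddChar i ≠ 0 := by decide +revert

theorem signAddChar_mul_self (i : ZMod 2) : signAddChar i * signAddChar i = 1 := by
  decide +revert

theorem ZMod.eq_zero_or_eq_one (i : ZMod 2) : i = 0 ∨ i = 1 := by decide +revert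

theorem exists_eq_mul_signAddChar {w s : ℤ} (h : w ^ 2 = s ^ 2) : ∃ i, w = s * signAddChar i := by
  rcases sq_eq_sq_iff_eq_or_eq_neg.mp h with rfl | rfl
  · exact ⟨0, by rw [signAddChar_zero, mul_one]⟩
  · exact ⟨1, by rw [signAddChar_one, mul_neg_one]⟩

theorem ncard_signed_units_sub_eq {W : L → ℤ} {s : ℤ} (hs : s ≠ 0) (hW0 : W 0 = 0)
    (hW : ∀ b, W b ≠ 0 → W b ^ 2 = s ^ 2) (g : Additive Lˣ) (i : ZMod 2) :
    {p : (Additive Lˣ × ZMod 2) × (Additive Lˣ × ZMod 2) |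
      p.1 ∈ {x : Additive Lˣ × ZMod 2 | W (x.1.toMul : L) = s * signAddChar x.2} ∧
      p.2 ∈ {x : Additive Lˣ × ZMod 2 | W (x.1.toMul : L) = s * signAddChar x.2} ∧
      p.1 - p.2 = (g, i)}.ncard
      = {b : L | W ((g.toMul : L) * b) * W b = s ^ 2 * signAddChar i}.ncard := by
  refine Set.ncard_congr (fun p _ => (p.2.1.toMul : L)) ?_ ?_ ?_
  · rintro ⟨a, b, j⟩ ⟨ha, hb, hab⟩
    rw [sub_eq_iff_eq_add] at hab
    change a = (g, i) + (b, j) at hab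
    subst hab
    change W ((g.toMul : L) * (b.toMul : L)) = s * signAddChar (i + j) at ha
    change W (b.toMul : L) = s * signAddChar j at hb
    change W ((g.toMul : L) * (b.toMul : L)) * W (b.toMul : L) = _
    have := signAddChar_mul_self j
    rw [ha, hb, AddChar.map_add_eq_mul]
    linear_combination s ^ 2 * signAddChar i * this
  · rintro ⟨a, b, j⟩ ⟨a', b', j'⟩ ⟨ha, hb, hab⟩ ⟨ha', hb', hab'⟩ h
    have h1 : b = b' := Units.ext h
    change W (b.toMul : L) = s * signAddChar j at hb
    change W (b'.toMul : L) = s * signAddChar j' at hb'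
    have h2 : j = j' := by
      rw [h1, hb'] at hb
      exact (signAddChar_injective (mul_left_cancel₀ hs hb)).symm
    rw [sub_eq_iff_eq_add] at hab hab'
    change a = _ + (b, j) at hab
    change a' = _ + (b', j') at hab'
    rw [hab, hab', h1, h2]
  · intro b hb
    change W ((g.toMul : L) * b) * W b = _ at hb
    have hne : W ((g.toMul : L) * b) * W b ≠ 0 := by
      rw [hb]
      exact mul_ne_zero (pow_ne_zero 2 hs) (signAddChar_ne_zero i)
    have hb0 : b ≠ 0 := by
      rintro rfl
      exact right_ne_zero_of_mul hne hW0
    obtain ⟨j, hj⟩ := exists_eq_mul_signAddChar (hW b (right_ne_zero_of_mul hne))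
    refine ⟨((g, i) + (Additive.ofMul (Units.mk0 b hb0), j),
      (Additive.ofMul (Units.mk0 b hb0), j)), ⟨?_, hj, add_sub_cancel_right _ _⟩, rfl⟩
    change W ((g.toMul : L) * b) = s * signAddChar (i + j)
    have := signAddChar_mul_self j
    rw [hj] at hb
    rw [AddChar.map_add_eq_mul]
    refine mul_right_cancel₀ hs ?_
    linear_combination signAddChar j * hb - W ((g.toMul : L) * b) * s * this

theorem isAddRDS_of_bent [Fintype L] {q d : ℕ} (hq : Nat.card K = q)
    (hd : Module.finrank K L = d) (hd2 : 2 ≤ d) {W : L → ℤ} {s : ℤ} (hs : s ≠ 0)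
    (hW1 : ∀ b, Algebra.trace K L b = 1 → W b ^ 2 = s ^ 2)
    (hW0 : ∀ b, Algebra.trace K L b ≠ 1 → W b = 0)
    (hcorr : ∀ g : L, g ≠ 1 → ∑ b, W (g * b) * W b = 0) :
    IsAddRDS ((q ^ d - 1) / (q - 1)) (2 * (q - 1)) (q ^ (d - 1)) (q ^ (d - 2) / 2)
      ((unitsAddSubgroup K L).prod (⊤ : AddSubgroup (ZMod 2)))
      {x : Additive Lˣ × ZMod 2 | W (x.1.toMul : L) = s * signAddChar x.2} := by
  classical
  have h := isAddRDS_trace_eq_one hq hd hd2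
  have hWne : ∀ b, W b ≠ 0 → Algebra.trace K L b = 1 := fun b hb => by
    by_contra h1
    exact hb (hW0 b h1)
  have hW : ∀ b, W b ≠ 0 → W b ^ 2 = s ^ 2 := fun b hb => hW1 b (hWne b hb)
  have hW00 : W 0 = 0 := hW0 0 (by simp)
  have hWne' : ∀ b, Algebra.trace K L b = 1 → W b ≠ 0 := fun b hb h1 => by
    have := hW1 b hb
    rw [h1] at this
    exact hs (pow_eq_zero_iff two_ne_zero |>.mp (by simpa using this.symm))
  refine ⟨?_, ?_, ?_, ?_, ?_⟩
  · rw [Nat.card_prod, h.1, Nat.card_zmod]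
    ring
  · rw [Nat.card_congr (AddSubgroup.prodEquiv _ _).toEquiv, Nat.card_prod, h.2.1,
      AddSubgroup.card_top, Nat.card_zmod, mul_comm]
  · rw [← h.2.2.1]
    refine Set.ncard_congr (fun x _ => x.1) ?_ ?_ ?_
    · rintro ⟨b, i⟩ hb
      refine hWne _ ?_
      rw [show W (b.toMul : L) = _ from hb]
      exact mul_ne_zero hs (signAddChar_ne_zero i)
    · rintro ⟨b, i⟩ ⟨b', i'⟩ hb hb' hbb
      change b = b' at hbb
      subst hbb
      exact Prod.ext rfl (signAddChar_injective (mul_left_cancel₀ hs (hb.symm.trans hb')))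
    · intro b hb
      obtain ⟨i, hi⟩ := exists_eq_mul_signAddChar (hW1 _ hb)
      exact ⟨(b, i), hi, rfl⟩
  · rintro ⟨g, i⟩ hg
    rw [ncard_signed_units_sub_eq hs hW00 hW]
    have hg' : ∀ a : K, algebraMap K L a ≠ g.toMul := by
      intro a ha
      exact hg ⟨mem_unitsAddSubgroup_iff.mpr ⟨a, ha⟩, trivial⟩
    have hcount := Algebra.ncard_trace_eq_one_and hg'
    have hL : Nat.card L = q ^ d := by
      have : Finite K := Finite.of_injective _ (algebraMap K L).injective
      rw [← hq, ← hd, Module.natCard_eq_pow_finrank (K := K)]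
    have hqpos : 0 < q := by
      have : Finite K := Finite.of_injective _ (algebraMap K L).injective
      exact hq ▸ Nat.card_pos
    rw [hq, hL] at hcount
    have h2 : q ^ d = q ^ (d - 2) * q ^ 2 := by rw [← pow_add]; congr 1; omega
    rw [← Nat.eq_of_mul_eq_mul_right (pow_pos hqpos 2) (hcount.trans h2)]
    have hzero := hcorr g.toMul (fun h1 => hg' 1 (by rw [map_one, h1]))
    have hsplit : ∀ b : L, W ((g.toMul : L) * b) * W b = s ^ 2 *
        ((if W ((g.toMul : L) * b) * W b = s ^ 2 * signAddChar 0 then 1 else 0)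
          - (if W ((g.toMul : L) * b) * W b = s ^ 2 * signAddChar 1 then 1 else 0)) := by
      intro b
      rw [signAddChar_zero, signAddChar_one]
      have hs2 : s ^ 2 ≠ 0 := pow_ne_zero 2 hs
      have h3 : s ^ 2 * (-1) ≠ s ^ 2 * 1 := fun h3 => by
        have := mul_left_cancel₀ hs2 h3
        norm_num at this
      by_cases h4 : W ((g.toMul : L) * b) * W b = 0
      · rw [h4]
        simp [hs2.symm, hs]
      · have h5 : (W ((g.toMul : L) * b) * W b) ^ 2 = (s ^ 2) ^ 2 := by
          rw [mul_pow, hW _ (left_ne_zero_of_mul h4), hW _ (right_ne_zero_of_mul h4)]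
          ring
        obtain ⟨j, hj⟩ := exists_eq_mul_signAddChar h5
        rcases ZMod.eq_zero_or_eq_one j with rfl | rfl
        · rw [signAddChar_zero] at hj
          rw [hj, if_pos rfl, if_neg h3.symm]
          ring
        · rw [signAddChar_one] at hj
          rw [hj, if_pos rfl, if_neg h3]
          ring
    have heq : {b : L | W ((g.toMul : L) * b) * W b = s ^ 2 * signAddChar 0}.ncard
        = {b : L | W ((g.toMul : L) * b) * W b = s ^ 2 * signAddChar 1}.ncard := by
      rw [Finset.sum_congr rfl fun b _ => hsplit b, ← Finset.mul_sum, Finset.sum_sub_distrib,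
        Finset.sum_boole, Finset.sum_boole] at hzero
      have h6 := (mul_eq_zero.mp hzero).resolve_left (pow_ne_zero 2 hs)
      rw [sub_eq_zero] at h6
      rw [← Set.ncard_coe_finset, ← Set.ncard_coe_finset] at h6
      simpa using h6
    have hunion : {x | Algebra.trace K L ((g.toMul : L) * x) = 1 ∧ Algebra.trace K L x = 1}
        = {b : L | W ((g.toMul : L) * b) * W b = s ^ 2 * signAddChar 0}
          ∪ {b : L | W ((g.toMul : L) * b) * W b = s ^ 2 * signAddChar 1} := by
      ext b
      constructor
      · rintro ⟨h3, h4⟩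
        have h5 : (W ((g.toMul : L) * b) * W b) ^ 2 = (s ^ 2) ^ 2 := by
          rw [mul_pow, hW1 _ h3, hW1 _ h4]
          ring
        obtain ⟨j, hj⟩ := exists_eq_mul_signAddChar h5
        rcases ZMod.eq_zero_or_eq_one j with rfl | rfl
        · exact Or.inl hj
        · exact Or.inr hj
      · intro h3
        have h4 : W ((g.toMul : L) * b) * W b ≠ 0 := by
          rcases h3 with h3 | h3 <;> rw [show _ = _ from h3] <;>
            exact mul_ne_zero (pow_ne_zero 2 hs) (signAddChar_ne_zero _)
        exact ⟨hWne _ (left_ne_zero_of_mul h4), hWne _ (right_ne_zero_of_mul h4)⟩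
    rw [hunion, Set.ncard_union_eq]
    · rcases ZMod.eq_zero_or_eq_one i with rfl | rfl <;> omega
    · rw [Set.disjoint_left]
      intro b h3 h4
      have h5 := mul_left_cancel₀ (pow_ne_zero 2 hs) ((show _ = _ from h3).symm.trans h4)
      exact absurd (signAddChar_injective h5) (by decide)
  · rintro ⟨g, i⟩ ⟨hg, -⟩ hgi
    rw [ncard_signed_units_sub_eq hs hW00 hW, Set.ncard_eq_zero (Set.toFinite _),
      Set.eq_empty_iff_forall_notMem]
    intro b hb
    change W ((g.toMul : L) * b) * W b = _ at hb
    have hne : W ((g.toMul : L) * b) * W b ≠ 0 := by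
      rw [hb]
      exact mul_ne_zero (pow_ne_zero 2 hs) (signAddChar_ne_zero i)
    obtain ⟨a, ha⟩ := mem_unitsAddSubgroup_iff.mp hg
    have h1 := hWne _ (left_ne_zero_of_mul hne)
    have h2 := hWne _ (right_ne_zero_of_mul hne)
    change algebraMap K L a = (g.toMul : L) at ha
    rw [← ha, ← Algebra.smul_def, map_smul, h2, smul_eq_mul, mul_one] at h1
    rw [h1, map_one] at ha
    have hg0 : g = 0 := Units.ext ha.symm
    rw [← ha, one_mul, ← sq, hW1 b h2] at hb
    have hi : i = 0 := by
      refine signAddChar_injective (mul_left_cancel₀ (pow_ne_zero 2 hs) ?_)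
      rw [← hb, signAddChar_zero, mul_one]
    exact hgi (by rw [hg0, hi]; rfl)

end Bent

section Gold

variable (F : Type*) [Field F] [Algebra (ZMod 2) F]

/-- The additive character `(-1) ^ Tr x` of a field of characteristic two. -/
noncomputable def signTrace : AddChar F ℤ :=
  signAddChar.compAddMonoidHom (Algebra.trace (ZMod 2) F).toAddMonoidHom

theorem signTrace_apply (x : F) : signTrace F x = signAddChar (Algebra.trace (ZMod 2) F x) := rfl

theorem signTrace_algEquiv (e : F ≃ₐ[ZMod 2] F) (x : F) : signTrace F (e x) = signTrace F x := by
  rw [signTrace_apply, signTrace_apply, Algebra.trace_eq_of_algEquiv]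

variable [Fintype F]

theorem signTrace_sq (x : F) : signTrace F (x ^ 2) = signTrace F x := by
  simpa using
    signTrace_algEquiv F (FiniteField.frobeniusAlgEquivOfAlgebraic (ZMod 2) F) x

theorem sum_signTrace_mul [DecidableEq F] (c : F) :
    ∑ x, signTrace F (x * c) = if c = 0 then (Fintype.card F : ℤ) else 0 := by
  refine (AddChar.sum_mulShift c (AddChar.IsPrimitive.of_ne_one fun h => ?_)).trans (by simp)
  obtain ⟨x, hx⟩ := Algebra.trace_surjective (ZMod 2) F 1
  have := DFunLike.congr_fun h x
  rw [signTrace_apply, hx, signAddChar_one] at this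
  norm_num at this

variable {F} {K L : Type*} [Field K] [Field L] [Fintype K] [Fintype L] [Algebra K L]

local notation "σ" => FiniteField.frobeniusAlgEquivOfAlgebraic K L

theorem FiniteField.mem_range_algebraMap_of_frobenius_frobenius (hd : Odd (Module.finrank K L))
    {z : L} (hz : σ (σ z) = z) : z ∈ Set.range (algebraMap K L) := by
  have h1 : Function.IsPeriodicPt σ 2 z := hz
  have h2 : Function.IsPeriodicPt σ (Module.finrank K L) z := by
    have := pow_orderOf_eq_one σ
    rw [FiniteField.orderOf_frobeniusAlgEquivOfAlgebraic] at this
    have h3 := DFunLike.congr_fun this z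
    rwa [AlgEquiv.coe_pow] at h3
  have h3 := h1.gcd h2
  rw [Nat.Coprime.gcd_eq_one (Nat.coprime_two_left.mpr hd)] at h3
  rw [IsGalois.mem_range_algebraMap_iff_fixed]
  intro f
  obtain ⟨n, rfl⟩ := (FiniteField.bijective_frobeniusAlgEquivOfAlgebraic_pow K L).2 f
  change (σ ^ n.1) z = z
  rw [AlgEquiv.coe_pow]
  exact Function.IsFixedPt.iterate h3 n.1

theorem FiniteField.mul_frobenius_injective (hK : Even (Fintype.card K))
    (hd : Odd (Module.finrank K L)) : Function.Injective fun x : L => x * σ x := by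
  have hmul : ∀ x : L, x * σ x = x ^ (Fintype.card K + 1) := fun x => by
    rw [FiniteField.coe_frobeniusAlgEquivOfAlgebraic, pow_succ']
  have hcop : (Nat.card Lˣ).Coprime (Fintype.card K + 1) := by
    rw [Nat.card_units, Nat.card_eq_fintype_card, Module.card_eq_pow_finrank (K := K) (V := L)]
    set q := Fintype.card K
    have hdvd : q + 1 ∣ q ^ Module.finrank K L + 1 := by
      simpa using hd.nat_add_dvd_pow_add_pow q 1
    have hpos : 0 < q ^ Module.finrank K L := pow_pos Fintype.card_pos _
    have h1 : Nat.gcd (q ^ Module.finrank K L - 1) (q + 1) ∣ 2 := by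
      have h2 := (Nat.gcd_dvd_right (q ^ Module.finrank K L - 1) (q + 1)).trans hdvd
      have h3 := Nat.dvd_sub h2 (Nat.gcd_dvd_left (q ^ Module.finrank K L - 1) (q + 1))
      rwa [show q ^ Module.finrank K L + 1 - (q ^ Module.finrank K L - 1) = 2 by omega] at h3
    refine ((Nat.dvd_prime Nat.prime_two).mp h1).resolve_right fun h2 => ?_
    have h3 := Nat.gcd_dvd_right (q ^ Module.finrank K L - 1) (q + 1)
    rw [h2] at h3
    exact (Nat.not_even_iff_odd.mpr hK.add_one) (even_iff_two_dvd.mpr h3)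
  intro x y hxy
  simp only [hmul] at hxy
  by_cases hx : x = 0
  · subst hx
    rw [zero_pow (Nat.succ_ne_zero _)] at hxy
    exact (pow_eq_zero_iff (Nat.succ_ne_zero _) |>.mp hxy.symm).symm
  · have hy : y ≠ 0 := by
      rintro rfl
      rw [zero_pow (Nat.succ_ne_zero _)] at hxy
      exact hx (pow_eq_zero_iff (Nat.succ_ne_zero _) |>.mp hxy)
    have := (Nat.Coprime.pow_left_bijective hcop).1 (a₁ := Units.mk0 x hx) (a₂ := Units.mk0 y hy)
      (Units.ext hxy)
    exact congrArg Units.val this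

variable [Algebra (ZMod 2) K] [Algebra (ZMod 2) L] [IsScalarTower (ZMod 2) K L]

variable (K) in
/-- The Walsh transform of the quadratic form `x ↦ Tr (x * σ x)`, with `σ` the Frobenius
automorphism of `L` over `K`. -/
noncomputable def goldWalsh (b : L) : ℤ := ∑ x : L, signTrace L (x * σ x + b * x)

theorem signTrace_mul_algebraMap (c : L) (a : K) :
    signTrace L (c * algebraMap K L a) = signTrace K (a * Algebra.trace K L c) := by
  rw [signTrace_apply, signTrace_apply, ← Algebra.trace_trace (S := K), mul_comm,
    ← Algebra.smul_def, map_smul, smul_eq_mul]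

theorem signTrace_frobenius (x : L) : signTrace L (σ x) = signTrace L x :=
  signTrace_algEquiv L ((σ).restrictScalars (ZMod 2)) x

theorem goldWalsh_sq [DecidableEq K] (hd : Odd (Module.finrank K L)) (b : L) :
    goldWalsh K b ^ 2 = if Algebra.trace K L b = 1 then
      (Fintype.card L : ℤ) * Fintype.card K else 0 := by
  classical
  have : CharP L 2 := charP_of_injective_algebraMap (algebraMap (ZMod 2) L).injective 2
  have : CharP K 2 := charP_of_injective_algebraMap (algebraMap (ZMod 2) K).injective 2
  have h2 : (2 : L) = 0 := CharTwo.two_eq_zero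
  have hinner : ∀ z : L, ∑ y, signTrace L (y * σ z + z * σ y)
      = if σ (σ z) = z then (Fintype.card L : ℤ) else 0 := by
    intro z
    have h1 : ∀ y, signTrace L (y * σ z + z * σ y) = signTrace L (σ y * (σ (σ z) + z)) := by
      intro y
      rw [AddChar.map_add_eq_mul, ← signTrace_frobenius (K := K) (y * σ z), map_mul,
        ← AddChar.map_add_eq_mul]
      congr 1
      ring
    rw [Finset.sum_congr rfl fun y _ => h1 y]
    refine (Equiv.sum_comp (σ).toEquiv fun w => signTrace L (w * (σ (σ z) + z))).trans ?_
    rw [sum_signTrace_mul]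
    simp only [CharTwo.add_eq_zero]
  have hW : goldWalsh K b ^ 2
      = ∑ z, if σ (σ z) = z then
          signTrace L (z * σ z + b * z) * (Fintype.card L : ℤ) else 0 := by
    rw [sq, goldWalsh, Finset.sum_mul_sum, Finset.sum_comm]
    have h1 : ∀ y, ∑ x, signTrace L (x * σ x + b * x) * signTrace L (y * σ y + b * y)
        = ∑ z, signTrace L (z * σ z + b * z) * signTrace L (y * σ z + z * σ y) := by
      intro y
      rw [← Equiv.sum_comp (Equiv.addRight y)]
      refine Finset.sum_congr rfl fun z _ => ?_
      rw [← AddChar.map_add_eq_mul, ← AddChar.map_add_eq_mul, Equiv.coe_addRight, map_add σ]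
      congr 1
      linear_combination (y * σ y + b * y) * h2
    rw [Finset.sum_congr rfl fun y _ => h1 y, Finset.sum_comm]
    refine Finset.sum_congr rfl fun z _ => ?_
    rw [← Finset.mul_sum, hinner, mul_ite, mul_zero]
  have hfix : Finset.univ.filter (fun z : L => σ (σ z) = z)
      = Finset.univ.image (algebraMap K L) := by
    ext z
    simp only [Finset.mem_filter, Finset.mem_univ, true_and, Finset.mem_image]
    refine ⟨fun hz => FiniteField.mem_range_algebraMap_of_frobenius_frobenius hd hz, ?_⟩
    rintro ⟨a, rfl⟩
    rw [AlgEquiv.commutes, AlgEquiv.commutes]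
  have htr1 : Algebra.trace K L 1 = 1 := by
    rw [← map_one (algebraMap K L), Algebra.trace_algebraMap, nsmul_one]
    obtain ⟨k, hk⟩ := hd
    rw [hk]
    push_cast
    rw [CharTwo.two_eq_zero, zero_mul, zero_add]
  have hK : ∀ a : K, signTrace L (algebraMap K L a * σ (algebraMap K L a)
      + b * algebraMap K L a) = signTrace K (a * (1 + Algebra.trace K L b)) := by
    intro a
    rw [AlgEquiv.commutes, AddChar.map_add_eq_mul, ← sq, signTrace_sq,
      ← AddChar.map_add_eq_mul, ← one_add_mul, signTrace_mul_algebraMap, map_add, htr1]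
  rw [hW, ← Finset.sum_filter, hfix, Finset.sum_image fun _ _ _ _ h => (algebraMap K L).injective h,
    ← Finset.sum_mul, Finset.sum_congr rfl fun a _ => hK a, sum_signTrace_mul]
  simp only [CharTwo.add_eq_zero, eq_comm (a := (1 : K)), ite_mul, zero_mul]
  simp only [mul_comm]

omit [IsScalarTower (ZMod 2) K L] in
theorem sum_goldWalsh_mul (hd : Odd (Module.finrank K L)) {g : L} (hg : g ≠ 1) :
    ∑ b, goldWalsh K (g * b) * goldWalsh K b = 0 := by
  classical
  have : CharP L 2 := charP_of_injective_algebraMap (algebraMap (ZMod 2) L).injective 2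
  have : CharP K 2 := charP_of_injective_algebraMap (algebraMap (ZMod 2) K).injective 2
  have hinj := FiniteField.mul_frobenius_injective (K := K) (L := L)
    (by
      rw [even_iff_two_dvd, ← CharP.cast_eq_zero_iff K 2]
      exact Nat.cast_card_eq_zero K) hd
  have h1 : ∀ b, goldWalsh K (g * b) * goldWalsh K b
      = ∑ x, ∑ y, signTrace L (x * σ x + y * σ y) * signTrace L (b * (g * x + y)) := by
    intro b
    rw [goldWalsh, goldWalsh, Finset.sum_mul_sum]
    refine Finset.sum_congr rfl fun x _ => Finset.sum_congr rfl fun y _ => ?_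
    rw [← AddChar.map_add_eq_mul, ← AddChar.map_add_eq_mul]
    congr 1
    ring
  have h2 : ∀ x, ∑ b, ∑ y, signTrace L (x * σ x + y * σ y) * signTrace L (b * (g * x + y))
      = signTrace L (x * σ x * (1 + g * σ g)) * Fintype.card L := by
    intro x
    rw [Finset.sum_comm]
    have h3 : ∀ y, ∑ b, signTrace L (x * σ x + y * σ y) * signTrace L (b * (g * x + y))
        = if g * x = y then signTrace L (x * σ x + y * σ y) * Fintype.card L else 0 := by
      intro y
      rw [← Finset.mul_sum, sum_signTrace_mul, mul_ite, mul_zero]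
      simp only [CharTwo.add_eq_zero]
    rw [Finset.sum_congr rfl fun y _ => h3 y, Finset.sum_ite_eq, if_pos (Finset.mem_univ _), map_mul]
    congr 2
    ring
  have hne : 1 + g * σ g ≠ 0 := by
    rw [Ne, CharTwo.add_eq_zero]
    intro h
    exact hg (hinj (by simpa using h.symm))
  rw [Finset.sum_congr rfl fun b _ => h1 b, Finset.sum_comm, Finset.sum_congr rfl fun x _ => h2 x,
    ← Finset.sum_mul]
  have h4 := Equiv.sum_comp (Equiv.ofBijective _ (Finite.injective_iff_bijective.mp hinj))
    fun w => signTrace L (w * (1 + g * σ g))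
  rw [sum_signTrace_mul, if_neg hne] at h4
  exact mul_eq_zero_of_left h4 _

end Gold

theorem isCyclicAddRDS_of_dvd_two_mul {f d n : ℕ} (hf : f ≠ 0) (hd2 : 2 ≤ d) (hd : Odd d)
    (hn : 0 < n) (hdvd : n ∣ 2 * (2 ^ f - 1)) :
    IsCyclicAddRDS (((2 ^ f) ^ d - 1) / (2 ^ f - 1)) n ((2 ^ f) ^ (d - 1))
      ((2 ^ f) ^ (d - 2) * (2 ^ f - 1) / n) := by
  classical
  have : NeZero d := ⟨by omega⟩
  let K := GaloisField 2 f
  let L := FiniteField.Extension K 2 d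
  have : Fintype K := Fintype.ofFinite K
  have : Fintype L := Fintype.ofFinite L
  have hK : Nat.card K = 2 ^ f := GaloisField.card 2 f hf
  have hfr : Module.finrank K L = d := FiniteField.finrank_extension _ _ _
  have hL : Nat.card L = (2 ^ f) ^ d := by
    rw [Module.natCard_eq_pow_finrank (K := K), hK, hfr]
  have : CharP L 2 := charP_of_injective_algebraMap (algebraMap K L).injective 2
  let _ : Algebra (ZMod 2) L := ZMod.algebra L 2
  have : IsScalarTower (ZMod 2) K L :=
    IsScalarTower.of_algebraMap_eq' (Subsingleton.elim _ _)
  obtain ⟨e, he⟩ := hd.add_one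
  have hW : ∀ b : L, goldWalsh K b ^ 2
      = if Algebra.trace K L b = 1 then (((2 : ℤ) ^ f) ^ e) ^ 2 else 0 := by
    intro b
    rw [goldWalsh_sq (hfr.symm ▸ hd), ← Nat.card_eq_fintype_card, ← Nat.card_eq_fintype_card, hK, hL]
    push_cast
    rw [← pow_succ, he, ← two_mul, mul_comm 2 e, pow_mul _ e 2]
  have h := isAddRDS_of_bent hK hfr hd2 (W := goldWalsh K) (s := ((2 : ℤ) ^ f) ^ e)
    (by positivity) (fun b hb => by rw [hW, if_pos hb])
    (fun b hb => pow_eq_zero_iff two_ne_zero |>.mp (by rw [hW, if_neg hb]))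
    (fun g hg => sum_goldWalsh_mul (hfr.symm ▸ hd) hg)
  have hcyc : IsAddCyclic (Additive Lˣ × ZMod 2) := by
    rw [AddGroup.isAddCyclic_prod_iff]
    refine ⟨inferInstance, inferInstance, ?_⟩
    rw [Nat.card_zmod, Nat.coprime_two_right]
    change Odd (Nat.card Lˣ)
    rw [Nat.card_units, hL]
    refine Nat.Even.sub_odd (Nat.one_le_pow _ _ (by positivity)) ?_ odd_one
    exact ((even_two.pow_of_ne_zero hf).pow_of_ne_zero (by omega))
  obtain ⟨c, hc⟩ := hdvd
  have heven : 2 ∣ (2 ^ f) ^ (d - 2) := by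
    obtain ⟨k, hk⟩ := hd
    exact (dvd_pow_self 2 hf).trans (dvd_pow_self _ (by omega))
  obtain ⟨t, ht⟩ := heven
  have hl : (2 ^ f) ^ (d - 2) * (2 ^ f - 1) / n = c * ((2 ^ f) ^ (d - 2) / 2) := by
    rw [ht, Nat.mul_div_cancel_left _ two_pos]
    refine Nat.div_eq_of_eq_mul_left hn ?_
    calc 2 * t * (2 ^ f - 1) = t * (2 * (2 ^ f - 1)) := by ring
      _ = c * t * n := by rw [hc]; ring
  rw [hl]
  rw [hc, mul_comm n c] at h
  exact h.isCyclicAddRDS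

/-- Existence of cyclic relative difference sets lifting complements of classical Singer
difference sets: for `q` a prime power and `d ≥ 2`, a cyclic
`((q^d-1)/(q-1), n, q^(d-1), q^(d-2)*(q-1)/n)`-RDS exists iff `n ∣ q-1` when `q` is odd or
`d` is even, and iff `n ∣ 2*(q-1)` when `q` is even and `d` is odd. -/
theorem singer_rds_existence (q d n : ℕ) (hq : IsPrimePow q) (hd : 2 ≤ d) (hn : 0 < n)
    (hdvd : n ∣ q ^ (d - 2) * (q - 1)) :
    ((Odd q ∨ Even d) →
      (IsCyclicAddRDS ((q ^ d - 1) / (q - 1)) n (q ^ (d - 1)) (q ^ (d - 2) * (q - 1) / n) ↔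
        n ∣ q - 1)) ∧
    ((Even q ∧ Odd d) →
      (IsCyclicAddRDS ((q ^ d - 1) / (q - 1)) n (q ^ (d - 1)) (q ^ (d - 2) * (q - 1) / n) ↔
        n ∣ 2 * (q - 1))) := by
  obtain ⟨p, f, hp, hf, rfl⟩ := hq
  rw [← Nat.prime_iff] at hp
  refine ⟨fun hqd => ⟨fun h => ?_, isCyclicAddRDS_of_dvd hp hf.ne' hd hn⟩,
    fun hqd => ⟨fun h => ?_, ?_⟩⟩
  · refine (dvd_of_isCyclicAddRDS hp hf.ne' hd hn hdvd h).1 (hqd.imp_left ?_)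
    rintro hodd rfl
    exact Nat.not_even_iff_odd.mpr hodd (even_two.pow_of_ne_zero hf.ne')
  · exact (dvd_of_isCyclicAddRDS hp hf.ne' hd hn hdvd h).2
  · obtain rfl : p = 2 := hp.even_iff.mp (Nat.even_pow.mp hqd.1).1
    exact isCyclicAddRDS_of_dvd_two_mul hf.ne' hd hqd.2 hn
end

section
/- Let p be a prime, q = p^s a power of p, and suppose a cyclic (q²+q+1, n, q², (q²−q)/n)-relative difference set exists, where n = p^r·n₁ with p not dividing n₁ and r ≥ 1 (and n divides q²−q). Then n₁^e ≡ 1 (mod p^r), where e = 3s/gcd(3s, r). -/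
open Finset NumberField

theorem Ideal.map_eq_self_of_dvd_span_pow {O : Type*} [CommRing O] [IsDedekindDomain O]
    (σ : O ≃+* O) {d : O}
    (h : ∀ z, σ z - z ∈ (Ideal.span {d}).radical) (k : ℕ) (I : Ideal O)
    (hI : I ∣ Ideal.span {d} ^ k) : I.map (σ : O →+* O) = I := by
  induction I using UniqueFactorizationMonoid.induction_on_prime with
  | h₁ => simp
  | h₂ I hu =>
    rw [Ideal.isUnit_iff.1 hu, Ideal.map_top]
  | h₃ I P hI0 hP ih =>
    rw [Ideal.map_mul, ih ((dvd_mul_left _ _).trans hI)]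
    congr 1
    have hPd : Ideal.span {d} ≤ P :=
      Ideal.dvd_iff_le.1 (hP.dvd_of_dvd_pow ((dvd_mul_right _ _).trans hI))
    have hPp : P.IsPrime := Ideal.isPrime_of_prime hP
    have hPm : P.IsMaximal := hPp.isMaximal hP.ne_zero
    have hrad : (Ideal.span {d}).radical ≤ P := hPp.radical_le_iff.2 hPd
    have hle : P.map (σ : O →+* O) ≤ P := by
      rw [Ideal.map_le_iff_le_comap]
      intro x hx
      have := P.add_mem (hrad (h x)) hx
      simpa using this
    exact (Ideal.map_isMaximal_of_equiv σ).eq_of_le hPm.ne_top hle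

theorem pow_dvd_map_mul {O : Type*} [CommRing O] [IsDedekindDomain O]
    (σ : O ≃+* O) {d : O}
    (h : ∀ z, σ z - z ∈ (Ideal.span {d}).radical) {k : ℕ} {x y : O}
    (hxy : x * y = d ^ k) : d ^ k ∣ σ x * y := by
  have hx := Ideal.map_eq_self_of_dvd_span_pow σ h k (Ideal.span {x})
    ⟨Ideal.span {y}, by rw [Ideal.span_singleton_mul_span_singleton, hxy,
      Ideal.span_singleton_pow]⟩
  rw [Ideal.map_span, Set.image_singleton] at hx
  rw [← hxy]
  exact mul_dvd_mul_right (Ideal.span_singleton_le_span_singleton.1 hx.le) y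

theorem pow_sub_one_mem_radical {O : Type*} [CommRing O] {p r : ℕ} (hp : p.Prime) {z : O}
    (hz : z ^ p ^ r = 1) : z - 1 ∈ (Ideal.span {(p : O)}).radical := by
  refine ⟨p ^ r, Ideal.mem_span_singleton.2 ?_⟩
  obtain ⟨c, hc⟩ := exists_add_pow_prime_pow_eq hp (z - 1) 1 r
  rw [sub_add_cancel, hz] at hc
  exact ⟨-((z - 1) * 1 * c), by simp only [one_pow] at hc; linear_combination -hc⟩

theorem map_sub_self_mem_of_adjoin_eq_top {O : Type*} [CommRing O] (σ : O ≃+* O) (J : Ideal O)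
    {ζ : O} (hζ : Algebra.adjoin ℤ {ζ} = ⊤) (h : σ ζ - ζ ∈ J) (z : O) : σ z - z ∈ J := by
  have hz : z ∈ Algebra.adjoin ℤ {ζ} := by rw [hζ]; trivial
  induction hz using Algebra.adjoin_induction with
  | mem x hx => rwa [Set.mem_singleton_iff.1 hx]
  | algebraMap r => simp
  | add x y _ _ hx hy =>
    rw [map_add, add_sub_add_comm]
    exact J.add_mem hx hy
  | mul x y _ _ hx hy =>
    have : σ (x * y) - x * y = σ x * (σ y - y) + y * (σ x - x) := by rw [map_mul]; ring
    rw [this]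
    exact J.add_mem (J.mul_mem_left _ hy) (J.mul_mem_left _ hx)

theorem intCast_dvd_of_intCast_dvd_ringOfIntegers {K : Type*} [Field K] [NumberField K] {a b : ℤ}
    (h : (a : 𝓞 K) ∣ b) : a ∣ b := by
  have := map_dvd (Algebra.norm ℤ) h
  rw [← eq_intCast (algebraMap ℤ (𝓞 K)), ← eq_intCast (algebraMap ℤ (𝓞 K)),
    Algebra.norm_algebraMap, Algebra.norm_algebraMap] at this
  exact (Int.pow_dvd_pow_iff Module.finrank_pos.ne').1 this

theorem dvd_card_mul_of_forall_dvd_sum {O : Type*} [CommRing O] [IsDomain O] {v : ℕ} [NeZero v]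
    {ψ : AddChar (ZMod v) O} (hψ : ψ.IsPrimitive) {d : O} (E : ZMod v → ℤ)
    (h : ∀ j, d ∣ ∑ g, (E g : O) * ψ (j * g)) (g : ZMod v) : d ∣ ((v * E g : ℤ) : O) := by
  have : ∑ j, ψ (-(j * g)) * ∑ x, (E x : O) * ψ (j * x) = ((v * E g : ℤ) : O) := by
    calc _ = ∑ x, (E x : O) * ∑ j, ψ (j * (x - g)) := by
          simp_rw [Finset.mul_sum]
          rw [Finset.sum_comm]
          refine Finset.sum_congr rfl fun x _ => Finset.sum_congr rfl fun j _ => ?_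
          rw [mul_left_comm, ← AddChar.map_add_eq_mul]
          ring_nf
      _ = _ := by
          simp_rw [AddChar.sum_mulShift _ hψ, sub_eq_zero]
          simp [ZMod.card, mul_comm]
  rw [← this]
  exact Finset.dvd_sum fun j _ => (h j).mul_left _

theorem exists_ringOfIntegers_equiv {p r w v : ℕ} (hp : p.Prime) [NeZero v] (hv : v = p ^ r * w)
    {t : ℕ} (ht : t.Coprime v) (ht1 : w ∣ t - 1) (ht0 : 1 ≤ t)
    (K : Type*) [Field K] [NumberField K] [IsCyclotomicExtension {v} ℚ K] :
    ∃ (σ : 𝓞 K ≃+* 𝓞 K) (ψ : AddChar (ZMod v) (𝓞 K)), ψ.IsPrimitive ∧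
      (∀ g, σ (ψ g) = ψ (t * g)) ∧ ∀ z, σ z - z ∈ (Ideal.span {(p : 𝓞 K)}).radical := by
  have hζ := IsCyclotomicExtension.zeta_spec v ℚ K
  have hζ' := hζ.toInteger_isPrimitiveRoot
  set ζ : 𝓞 K := hζ.toInteger
  have hpow {a b : ℕ} (hab : (a : ZMod v) = b) : ζ ^ a = ζ ^ b := by
    rw [← AddChar.zmodChar_apply' hζ'.pow_eq_one, hab, AddChar.zmodChar_apply']
  obtain ⟨τ, hτ⟩ :=
    (IsCyclotomicExtension.Rat.galEquivZMod v K).surjective (ZMod.unitOfCoprime t ht)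
  obtain ⟨σ, hσ'⟩ : ∃ σ : 𝓞 K ≃+* 𝓞 K, ∀ x : 𝓞 K, (σ x : K) = τ (x : K) :=
    ⟨RingOfIntegers.mapRingEquiv (τ : K ≃+* K), fun _ => rfl⟩
  have hσ : σ ζ = ζ ^ t := by
    have h := IsCyclotomicExtension.Rat.galEquivZMod_apply_of_pow_eq v K τ hζ.pow_eq_one
    rw [hτ] at h
    rw [← hpow (a := (ZMod.unitOfCoprime t ht).val.val) (by simp)]
    apply RingOfIntegers.ext
    rw [hσ']
    exact h
  refine ⟨σ, AddChar.zmodChar v hζ'.pow_eq_one,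
    AddChar.zmodChar_primitive_of_primitive_root v hζ', fun g => ?_, fun z => ?_⟩
  · rw [AddChar.zmodChar_apply, AddChar.zmodChar_apply, map_pow, hσ, ← pow_mul]
    exact hpow (by simp)
  · refine map_sub_self_mem_of_adjoin_eq_top σ _
      (IsCyclotomicExtension.Rat.adjoin_singleton_eq_top hζ) ?_ z
    have : (ζ ^ (t - 1)) ^ p ^ r = 1 := by
      rw [← pow_mul, hζ'.pow_eq_one_iff_dvd, hv, mul_comm]
      exact mul_dvd_mul_right ht1 _
    have h := Ideal.mul_mem_left _ ζ (pow_sub_one_mem_radical hp this)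
    rwa [mul_sub, mul_one, ← pow_succ', Nat.sub_add_cancel ht0, ← hσ] at h

theorem sum_card_filter_mul {α β M : Type*} [Fintype β] [DecidableEq β] [CommSemiring M]
    (A : Finset α) (f : α → β) (u : β → M) :
    ∑ g, (#{p ∈ A | f p = g} : M) * u g = ∑ p ∈ A, u (f p) := by
  rw [← Finset.sum_fiberwise' A f u]
  simp [Finset.sum_const, nsmul_eq_mul]

section DifferenceCount

variable {G : Type*} [CommRing G] [DecidableEq G]

/-- The number of ways to write `g` as `t * a - b` with `a b ∈ R`. -/
def mulDiffCount (R : Finset G) (t g : G) : ℕ := #{x ∈ R ×ˢ R | t * x.1 - x.2 = g}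

theorem sum_mulDiffCount_mul [Fintype G] {M : Type*} [CommSemiring M] (R : Finset G) (t : G)
    (u : G → M) :
    ∑ g, (mulDiffCount R t g : M) * u g = ∑ a ∈ R, ∑ b ∈ R, u (t * a - b) := by
  rw [← Finset.sum_product', ← sum_card_filter_mul (R ×ˢ R) (fun x => t * x.1 - x.2) u]
  rfl

theorem mulDiffCount_eq_sum (R : Finset G) (t g : G) :
    mulDiffCount R t g = ∑ a ∈ R, ∑ b ∈ R, if t * a - b = g then 1 else 0 := by
  rw [mulDiffCount, Finset.card_filter, Finset.sum_product]

theorem sum_mulDiffCount_sq [Fintype G] (R : Finset G) (t : G) :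
    ∑ g, mulDiffCount R t g ^ 2 = ∑ g, mulDiffCount R 1 g * mulDiffCount R 1 (t * g) := by
  have h₁ := sum_mulDiffCount_mul R t (mulDiffCount R t)
  have h₂ := sum_mulDiffCount_mul R 1 (fun g => mulDiffCount R 1 (t * g))
  simp only [Nat.cast_id] at h₁ h₂
  simp_rw [sq]
  rw [h₁, h₂]
  simp_rw [mulDiffCount_eq_sum]
  refine Finset.sum_congr rfl fun a _ => ?_
  rw [Finset.sum_comm]
  refine Finset.sum_congr rfl fun a' _ => ?_
  refine Finset.sum_congr rfl fun b _ => ?_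
  refine Finset.sum_congr rfl fun b' _ => ?_
  congr 1
  rw [eq_iff_iff]
  constructor <;> intro h <;> linear_combination h

theorem sum_mulDiffCount_mul_addChar [Fintype G] {M : Type*} [CommRing M] (R : Finset G) (t j : G)
    (ψ : AddChar G M) :
    ∑ g, (mulDiffCount R t g : M) * ψ (j * g) =
      (∑ a ∈ R, ψ (t * (j * a))) * ∑ b ∈ R, ψ (-(j * b)) := by
  rw [sum_mulDiffCount_mul, Finset.sum_mul_sum]
  refine Finset.sum_congr rfl fun a _ => Finset.sum_congr rfl fun b _ => ?_
  rw [← AddChar.map_add_eq_mul]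
  ring_nf

end DifferenceCount

theorem eq_of_sum_sq_eq_sq_sum {α : Type*} (A : Finset α) (f : α → ℕ)
    (h : ∑ x ∈ A, f x ^ 2 = (∑ x ∈ A, f x) ^ 2) {x y : α} (hx : x ∈ A) (hy : y ∈ A)
    (hfx : f x ≠ 0) (hfy : f y ≠ 0) : x = y := by
  have key : ∀ z ∈ A, f z ^ 2 = f z * ∑ x ∈ A, f x := by
    refine (Finset.sum_eq_sum_iff_of_le fun z hz => ?_).1 ?_
    · rw [sq]
      exact Nat.mul_le_mul_left _ (Finset.single_le_sum (fun _ _ => Nat.zero_le _) hz)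
    · rw [h, ← Finset.sum_mul, sq]
  by_contra hne
  have hx' : f x = ∑ x ∈ A, f x :=
    Nat.eq_of_mul_eq_mul_left (Nat.pos_of_ne_zero hfx) (by rw [← key x hx, sq])
  have : f x + f y ≤ ∑ x ∈ A, f x := by
    classical
    rw [← Finset.sum_pair hne]
    exact Finset.sum_le_sum_of_subset (by simp [Finset.insert_subset_iff, hx, hy])
  omega

theorem sum_notMem_addChar_eq_zero {G M : Type*} [CommRing G] [Fintype G] [CommRing M] [IsDomain M]
    (N : AddSubgroup G) [DecidablePred (· ∈ N)] (ψ : AddChar G M) (j : G) {h : G} (hN : h ∈ N)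
    (hψ : ψ (j * h) ≠ 1) : ∑ g with g ∉ N, ψ (j * g) = 0 := by
  have key : ∑ g with g ∉ N, ψ (j * g) = ψ (j * h) * ∑ g with g ∉ N, ψ (j * g) := by
    rw [Finset.mul_sum]
    refine Finset.sum_equiv (Equiv.addRight (-h)) (fun g => ?_) fun g _ => ?_
    · simp [N.add_mem_cancel_right (N.neg_mem hN)]
    · rw [← AddChar.map_add_eq_mul, Equiv.coe_addRight]
      ring_nf
  have : (1 - ψ (j * h)) * ∑ g with g ∉ N, ψ (j * g) = 0 := by linear_combination key
  exact (mul_eq_zero.1 this).resolve_left (sub_ne_zero.2 hψ.symm)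

/-- If `σ_t` lies in the inertia groups above `p`, the character values of `(tR)(-R) - L(G - N)` are
divisible by `p ^ k`, so Fourier inversion makes its coefficients divisible by `p ^ k` up to `v`. -/
theorem pow_dvd_mul_mulDiffCount_sub {p r w v k L t : ℕ} (hp : p.Prime) [NeZero v]
    (hv : v = p ^ r * w) (ht : t.Coprime v) (ht1 : w ∣ t - 1) (ht0 : 1 ≤ t)
    (N : AddSubgroup (ZMod v)) [DecidablePred (· ∈ N)] (R : Finset (ZMod v))
    (hR : ∀ g, mulDiffCount R 1 g = if g = 0 then p ^ k else if g ∈ N then 0 else L)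
    (htN : ∀ a : ZMod v, t * a - a ∈ N) (g : ZMod v) :
    (p : ℤ) ^ k ∣ v * (mulDiffCount R (t : ZMod v) g - if g ∈ N then 0 else (L : ℤ)) := by
  obtain ⟨K, _, _, _⟩ : ∃ (K : Type) (_ : Field K) (_ : NumberField K),
      IsCyclotomicExtension {v} ℚ K :=
    ⟨CyclotomicField v ℚ, inferInstance, inferInstance, by
      convert CyclotomicField.isCyclotomicExtension v ℚ
      · rfl
      · exact Subsingleton.elim _ _⟩
  obtain ⟨σ, ψ, hψ, hσ, hrad⟩ := exists_ringOfIntegers_equiv hp hv ht ht1 ht0 K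
  suffices h : (((p : ℤ) ^ k : ℤ) : 𝓞 K) ∣
      ((v * (mulDiffCount R (t : ZMod v) g - if g ∈ N then 0 else (L : ℤ)) : ℤ) : 𝓞 K) from
    intCast_dvd_of_intCast_dvd_ringOfIntegers h
  push_cast
  have main := dvd_card_mul_of_forall_dvd_sum (d := (p : 𝓞 K) ^ k) hψ
    (fun g => mulDiffCount R (t : ZMod v) g - if g ∈ N then 0 else (L : ℤ)) (fun j => ?_) g
  · push_cast at main
    exact main
  have hsplit : ∑ g, ((if g ∈ N then 0 else (L : ℤ) : ℤ) : 𝓞 K) * ψ (j * g) =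
      L * ∑ g with g ∉ N, ψ (j * g) := by
    rw [Finset.mul_sum, Finset.sum_filter]
    refine Finset.sum_congr rfl fun g _ => ?_
    by_cases hg : g ∈ N <;> simp [hg]
  have hE : ∑ g, ((mulDiffCount R (t : ZMod v) g - if g ∈ N then 0 else (L : ℤ) : ℤ) : 𝓞 K) *
      ψ (j * g) = (∑ a ∈ R, ψ (t * (j * a))) * ∑ b ∈ R, ψ (-(j * b)) -
        L * ∑ g with g ∉ N, ψ (j * g) := by
    rw [← hsplit, ← sum_mulDiffCount_mul_addChar, ← Finset.sum_sub_distrib]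
    refine Finset.sum_congr rfl fun g _ => ?_
    push_cast
    ring
  have hC : (∑ a ∈ R, ψ (j * a)) * ∑ b ∈ R, ψ (-(j * b)) =
      (p : 𝓞 K) ^ k + L * ∑ g with g ∉ N, ψ (j * g) := by
    have h := sum_mulDiffCount_mul_addChar R 1 j ψ
    simp only [one_mul] at h
    rw [← h, ← hsplit]
    have h0 : (p : 𝓞 K) ^ k = ∑ g, if g = 0 then (p : 𝓞 K) ^ k * ψ (j * g) else 0 := by simp
    rw [h0, ← Finset.sum_add_distrib]
    refine Finset.sum_congr rfl fun g _ => ?_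
    rw [hR]
    by_cases hg0 : g = 0
    · simp [hg0, N.zero_mem]
    · by_cases hg : g ∈ N <;> simp [hg, hg0]
  rw [hE]
  by_cases hj : ∃ h ∈ N, ψ (j * h) ≠ 1
  · obtain ⟨h, hN, hne⟩ := hj
    rw [sum_notMem_addChar_eq_zero N ψ j hN hne, mul_zero, add_zero] at hC
    rw [sum_notMem_addChar_eq_zero N ψ j hN hne, mul_zero, sub_zero]
    have := pow_dvd_map_mul σ hrad hC
    rwa [map_sum, Finset.sum_congr rfl fun a _ => hσ (j * a)] at this
  · push Not at hj
    have : ∑ a ∈ R, ψ (t * (j * a)) = ∑ a ∈ R, ψ (j * a) := by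
      refine Finset.sum_congr rfl fun a _ => ?_
      rw [show (t : ZMod v) * (j * a) = j * (t * a - a) + j * a by ring,
        AddChar.map_add_eq_mul, hj _ (htN a), one_mul]
    rw [this, hC, add_sub_cancel_right]

theorem mul_sub_eq_mul_sub_of_mulDiffCount {G : Type*} [CommRing G] [Fintype G] [DecidableEq G]
    {k L : ℕ} (N : AddSubgroup G) [DecidablePred (· ∈ N)] (R : Finset G) (t : G)
    (hR : ∀ g, mulDiffCount R 1 g = if g = 0 then k else if g ∈ N then 0 else L)
    (hk : #R = k) (hL : k ^ 2 = k + L * #{g : G | g ∉ N})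
    (htN : ∀ a, t * a - a ∈ N) (hle : ∀ g ∉ N, L ≤ mulDiffCount R t g)
    {a b : G} (ha : a ∈ R) (hb : b ∈ R) : t * a - a = t * b - b := by
  have hpos : ∀ a ∈ R, mulDiffCount R t (t * a - a) ≠ 0 := fun a ha =>
    Finset.card_ne_zero_of_mem (a := (a, a)) (by simp [ha])
  have htot : ∑ g, mulDiffCount R t g = k ^ 2 := by
    have h := sum_mulDiffCount_mul R t (fun _ => 1)
    simpa [hk, sq] using h
  have hNge : k ≤ ∑ g with g ∈ N, mulDiffCount R t g := by
    rw [Finset.sum_filter]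
    have h := sum_mulDiffCount_mul R t (fun g => if g ∈ N then 1 else 0)
    simp only [Nat.cast_id, mul_ite, mul_one, mul_zero] at h
    rw [h, ← hk, Finset.card_eq_sum_ones]
    refine Finset.sum_le_sum fun a ha => ?_
    refine le_trans ?_ (Finset.single_le_sum (fun _ _ => Nat.zero_le _) ha)
    simp [htN a]
  have hsum := Finset.sum_filter_add_sum_filter_not univ (· ∈ N) (mulDiffCount R t)
  have hge : ∑ g with g ∉ N, L ≤ ∑ g with g ∉ N, mulDiffCount R t g :=
    Finset.sum_le_sum fun g hg => hle g (by simpa using hg)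
  have hconst : ∑ g with g ∉ N, L = L * #{g : G | g ∉ N} := by
    rw [Finset.sum_const, smul_eq_mul, mul_comm]
  have heq : ∀ g ∉ N, mulDiffCount R t g = L := fun g hg =>
    ((Finset.sum_eq_sum_iff_of_le (s := {g : G | g ∉ N}) (f := fun _ => L)
      fun g hg => hle g (by simpa using hg)).1 (by omega) g (by simpa using hg)).symm
  have hsumN : ∑ g with g ∈ N, mulDiffCount R t g = k := by omega
  have hsq := sum_mulDiffCount_sq R t
  have hmem : ∀ g, t * g ∈ N ↔ g ∈ N := fun g => by
    rw [← N.add_mem_cancel_left (htN g) (y := g), sub_add_cancel]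
  rw [← Finset.sum_filter_add_sum_filter_not univ (· ∈ N),
    ← Finset.sum_filter_add_sum_filter_not univ (· ∈ N)
      (fun g => mulDiffCount R 1 g * mulDiffCount R 1 (t * g))] at hsq
  have h₁ : ∑ g with g ∉ N, mulDiffCount R t g ^ 2 =
      ∑ g with g ∉ N, mulDiffCount R 1 g * mulDiffCount R 1 (t * g) := by
    refine Finset.sum_congr rfl fun g hg => ?_
    have hg : g ∉ N := by simpa using hg
    have h0 : ∀ x ∉ N, x ≠ 0 := fun x hx h => hx (h ▸ N.zero_mem)
    have hg' : t * g ∉ N := by rwa [hmem]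
    rw [heq g hg, hR, hR, if_neg (h0 _ hg), if_neg hg, if_neg (h0 _ hg'), if_neg hg', sq]
  have h₂ : ∑ g with g ∈ N, mulDiffCount R 1 g * mulDiffCount R 1 (t * g) = k ^ 2 := by
    rw [Finset.sum_eq_single_of_mem 0 (by simp [N.zero_mem])]
    · simp [hR, sq]
    · intro g hg hg0
      have hg : g ∈ N := by simpa using hg
      simp [hR g, hg, hg0]
  exact eq_of_sum_sq_eq_sq_sum _ (mulDiffCount R t) (by rw [hsumN]; omega)
    (by simp [htN]) (by simp [htN]) (hpos a ha) (hpos b hb)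

theorem exists_nat_modEq_neg_one_one {p r w : ℕ} (hp : p.Prime) (hr : 1 ≤ r) (hw : p.Coprime w) :
    ∃ t : ℕ, 1 ≤ t ∧ t.Coprime (p ^ r * w) ∧ w ∣ t - 1 ∧ p ^ r ∣ t + 1 := by
  have hpr : 1 < p ^ r := Nat.one_lt_pow (by omega) hp.one_lt
  obtain ⟨t, h₁, h₂⟩ := Nat.chineseRemainder (hw.pow_left r) (p ^ r - 1) 1
  have h₁' : p ^ r ∣ t + 1 := by
    have := h₁.add_right 1
    rw [Nat.sub_add_cancel hpr.le] at this
    exact (Nat.modEq_zero_iff_dvd.1 (this.trans (by simp [Nat.ModEq])))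
  have ht0 : t ≠ 0 := by
    rintro rfl
    have := Nat.le_of_dvd one_pos h₁'
    omega
  refine ⟨t, by omega, Nat.Coprime.mul_right ?_ ?_, (Nat.modEq_iff_dvd' (by omega)).1 h₂.symm, h₁'⟩
  · exact Nat.Coprime.coprime_dvd_right h₁' (by simp)
  · rw [Nat.Coprime, h₂.gcd_eq, Nat.gcd_one_left]

theorem IsAddRDS.mulDiffCount_eq {v m n k L : ℕ} [NeZero v] {N : AddSubgroup (ZMod v)}
    [DecidablePred (· ∈ N)] {R : Finset (ZMod v)} (h : IsAddRDS m n k L N (R : Set (ZMod v)))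
    (g : ZMod v) :
    mulDiffCount R 1 g = if g = 0 then k else if g ∈ N then 0 else L := by
  obtain ⟨-, -, hk, hL, h0⟩ := h
  have hcount : mulDiffCount R 1 g =
      {x : ZMod v × ZMod v | x.1 ∈ (R : Set (ZMod v)) ∧ x.2 ∈ (R : Set (ZMod v)) ∧
        x.1 - x.2 = g}.ncard := by
    rw [mulDiffCount, ← Set.ncard_coe_finset]
    congr 1
    ext x
    simp [and_assoc]
  split_ifs with hg hgN
  · rw [← hk, Set.ncard_coe_finset, mulDiffCount]
    refine Finset.card_bij' (fun x _ => x.1) (fun a _ => (a, a)) ?_ ?_ ?_ ?_ <;>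
      simp +contextual [hg, sub_eq_zero]
  · rw [hcount, h0 g hgN hg]
  · rw [hcount, hL g hgN]

/-- Any `t` with `t ≡ 1` modulo the `p`-free part of the group order fixes `R` up to translation;
taking `t ≡ -1 (mod p ^ r)` forces `p ^ r ∣ 2`. -/
theorem IsAddRDS.pow_dvd_two {p s r n₁ m v L : ℕ} (hp : p.Prime) (hs : 0 < s) (hr : 1 ≤ r)
    (hpn : ¬ p ∣ n₁) (hm : m = (p ^ s) ^ 2 + p ^ s + 1) (hvm : v = m * (p ^ r * n₁))
    (hL : (p ^ s) ^ 2 - p ^ s = p ^ r * n₁ * L) {R : Finset (ZMod v)}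
    (hRDS : IsAddRDS m (p ^ r * n₁) ((p ^ s) ^ 2) L (AddSubgroup.zmultiples (m : ZMod v))
      (R : Set (ZMod v))) : p ^ r ∣ 2 := by
  classical
  have hn₁ : 0 < n₁ := Nat.pos_of_ne_zero fun h => hpn (h ▸ dvd_zero p)
  have hq : 1 < p ^ s := Nat.one_lt_pow hs.ne' hp.one_lt
  have hn : 0 < p ^ r * n₁ := Nat.mul_pos (pow_pos hp.pos r) hn₁
  have hqL : (p ^ s) ^ 2 = p ^ s + p ^ r * n₁ * L := by
    have : p ^ s ≤ (p ^ s) ^ 2 := Nat.le_self_pow two_ne_zero _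
    omega
  have hL0 : 0 < L := by
    rcases Nat.eq_zero_or_pos L with rfl | h
    · nlinarith
    · exact h
  have hpm : p.Coprime m := by
    rw [hp.coprime_iff_not_dvd, hm, (Nat.dvd_add_right _)]
    · exact hp.one_lt.ne' ∘ Nat.dvd_one.1
    · exact dvd_add ((dvd_pow_self p hs.ne').trans (dvd_pow_self _ two_ne_zero))
        (dvd_pow_self p hs.ne')
  obtain ⟨t, ht0, ht, ht1, htp⟩ := exists_nat_modEq_neg_one_one hp hr
    (hpm.mul_right ((hp.coprime_iff_not_dvd).2 hpn))
  have hv : v = p ^ r * (m * n₁) := by rw [hvm]; ring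
  rw [← hv] at ht
  have : NeZero v := ⟨hvm ▸ (Nat.mul_pos (by omega) hn).ne'⟩
  set N := AddSubgroup.zmultiples (m : ZMod v)
  have hR := hRDS.mulDiffCount_eq
  obtain ⟨-, hN, hk, -, -⟩ := hRDS
  rw [Set.ncard_coe_finset] at hk
  have htN : ∀ a : ZMod v, t * a - a ∈ N := fun a => by
    obtain ⟨c, hc⟩ := (dvd_mul_right m n₁).trans ht1
    refine AddSubgroup.mem_zmultiples_iff.2 ⟨(c * a.val : ℕ), ?_⟩
    have : (t : ZMod v) = m * c + 1 := by
      rw [← Nat.sub_add_cancel ht0, hc]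
      push_cast
      rfl
    rw [this, natCast_zsmul, nsmul_eq_mul]
    push_cast
    rw [ZMod.natCast_zmod_val]
    ring
  have hcard : #{g : ZMod v | g ∉ N} + p ^ r * n₁ = v := by
    have h := Finset.card_filter_add_card_filter_not (s := (univ : Finset (ZMod v))) (· ∈ N)
    have h' : #{g : ZMod v | g ∈ N} = p ^ r * n₁ := by
      rw [← hN, Nat.card_eq_fintype_card, Fintype.card_subtype]
    rw [h', Finset.card_univ, ZMod.card] at h
    omega
  have hle : ∀ g ∉ N, L ≤ mulDiffCount R (t : ZMod v) g := fun g hg => by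
    have hdiv := pow_dvd_mul_mulDiffCount_sub (k := 2 * s) hp hv ht ht1 ht0 N R
      (fun g => by rw [hR, ← pow_mul, mul_comm s]) htN g
    rw [if_neg hg, congrArg (Nat.cast (R := ℤ)) hv] at hdiv
    push_cast at hdiv
    rw [mul_right_comm] at hdiv
    have hcop : IsCoprime ((p : ℤ) ^ (2 * s)) (m * n₁) := by
      have := (hpm.mul_right ((hp.coprime_iff_not_dvd).2 hpn)).pow_left (2 * s)
      exact_mod_cast Nat.isCoprime_iff_coprime.2 this
    obtain ⟨c, hc⟩ := hcop.dvd_of_dvd_mul_right hdiv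
    by_contra! hlt
    have hlt' : (mulDiffCount R (t : ZMod v) g : ℤ) < L := by exact_mod_cast hlt
    have hpr : (0 : ℤ) < p ^ r := by exact_mod_cast pow_pos hp.pos r
    have hps : (0 : ℤ) < p ^ s := by exact_mod_cast pow_pos hp.pos s
    have hc0 : c < 0 := by
      by_contra! h
      have : (0 : ℤ) ≤ p ^ (2 * s) * c := mul_nonneg (by positivity) h
      nlinarith
    have hle : (p : ℤ) ^ (2 * s) ≤ p ^ r * L := by
      have h₁ : (p : ℤ) ^ (2 * s) * c ≤ p ^ (2 * s) * (-1) :=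
        mul_le_mul_of_nonneg_left (by omega) (by positivity)
      have h₂ : (0 : ℤ) ≤ p ^ r * mulDiffCount R (t : ZMod v) g := by positivity
      linarith
    have hle' : (p : ℤ) ^ r * L ≤ p ^ r * L * n₁ :=
      le_mul_of_one_le_right (by positivity) (by exact_mod_cast hn₁)
    have hqL' : ((p : ℤ) ^ s) ^ 2 = p ^ s + p ^ r * n₁ * L := by exact_mod_cast hqL
    rw [← pow_mul, mul_comm s] at hqL'
    linarith
  have hkL : ((p ^ s) ^ 2) ^ 2 = (p ^ s) ^ 2 + L * #{g : ZMod v | g ∉ N} := by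
    replace hcard := hcard.trans hvm
    zify at hcard hqL hm ⊢
    linear_combination ((p : ℤ) ^ s + (p ^ s) ^ 2) * hqL - L * hcard - L * (p ^ r * n₁) * hm
  have hconst : ∀ a ∈ R, ∀ b ∈ R, (t : ZMod v) * a - a = t * b - b := fun a ha b hb =>
    mul_sub_eq_mul_sub_of_mulDiffCount N R t hR hk hkL htN hle ha hb
  have h1 : (1 : ZMod v) ∉ N := fun h => by
    have : #{g : ZMod v | g ∉ N} = 0 := by
      rw [Finset.card_eq_zero, Finset.filter_eq_empty_iff]
      intro g _
      rw [not_not, ← ZMod.natCast_zmod_val g, ← nsmul_one]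
      exact N.nsmul_mem h _
    rw [this, zero_add] at hcard
    replace hcard := hcard.trans hvm
    nlinarith
  have hne : mulDiffCount R 1 (1 : ZMod v) ≠ 0 := by
    rw [hR, if_neg (fun h : (1 : ZMod v) = 0 => h1 (h ▸ N.zero_mem)), if_neg h1]
    exact hL0.ne'
  obtain ⟨x, hx⟩ := Finset.card_ne_zero.1 hne
  rw [Finset.mem_filter, Finset.mem_product, one_mul] at hx
  have ht_one : (t : ZMod v) = (1 : ℕ) := by
    have := hconst _ hx.1.1 _ hx.1.2
    push_cast
    linear_combination this - ((t : ZMod v) - 1) * hx.2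
  have hpt : p ^ r ∣ t - 1 :=
    (Dvd.intro _ hv.symm).trans
      ((Nat.modEq_iff_dvd' ht0).1 ((ZMod.natCast_eq_natCast_iff _ _ _).1 ht_one).symm)
  have := Nat.dvd_sub htp hpt
  rwa [show t + 1 - (t - 1) = 2 by omega] at this

/-- Lam's Theorem 3.1: if a cyclic `(q²+q+1, n, q², (q²-q)/n)`-RDS exists with `q = p^s` and
`n = p^r * n₁`, `p ∤ n₁`, `r ≥ 1`, then `n₁^e ≡ 1 (mod p^r)` where `e = 3s / gcd(3s, r)`. -/
theorem lam_3_1 (p s r n₁ : ℕ) (hp : p.Prime) (hs : 0 < s) (hr : 1 ≤ r)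
    (hpn : ¬ p ∣ n₁)
    (hdvd : p ^ r * n₁ ∣ (p ^ s) ^ 2 - p ^ s)
    (hRDS : IsCyclicAddRDS ((p ^ s) ^ 2 + p ^ s + 1) (p ^ r * n₁) ((p ^ s) ^ 2)
      (((p ^ s) ^ 2 - p ^ s) / (p ^ r * n₁))) :
    n₁ ^ (3 * s / Nat.gcd (3 * s) r) ≡ 1 [MOD p ^ r] := by
  have hn : 0 < p ^ r * n₁ :=
    Nat.mul_pos (pow_pos hp.pos r) (Nat.pos_of_ne_zero fun h => hpn (h ▸ dvd_zero p))
  have h2 : p ^ r ∣ 2 := by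
    obtain ⟨L, hL⟩ := hdvd
    obtain ⟨R, hRDS⟩ := hRDS
    rw [hL, Nat.mul_div_cancel_left _ hn] at hRDS
    have : NeZero (((p ^ s) ^ 2 + p ^ s + 1) * (p ^ r * n₁)) :=
      ⟨(Nat.mul_pos (Nat.succ_pos _) hn).ne'⟩
    rw [← Set.Finite.coe_toFinset R.toFinite] at hRDS
    exact hRDS.pow_dvd_two hp hs hr hpn rfl rfl hL
  refine Nat.ModEq.of_dvd h2 ?_
  have hp2 : p = 2 :=
    (Nat.prime_dvd_prime_iff_eq hp Nat.prime_two).1 ((dvd_pow_self p (by omega)).trans h2)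
  subst hp2
  exact Nat.odd_iff.1 ((Nat.not_even_iff_odd.1 (mt Even.two_dvd hpn)).pow)
end

section
/- Suppose a cyclic (m,n,k,λ)-relative difference set exists. Let q be a prime divisor of m·n with q ≡ 3 (mod 4), and let e ≥ 1 be such that q^e exactly divides m·n (q^e divides m·n but q^{e+1} does not) and q^e does not divide m. Suppose every prime p dividing k satisfies at least one of: (1) the multiplicative order of p modulo q^e is even, (2) the multiplicative order of p modulo q^e equals q^{e−1}(q−1)/2, or (3) p = q. Then the Diophantine equation 4k = x² + q·y² has a solution in integers x and y. -/
open NumberField Finset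

theorem AddChar.sum_eq_of_relative_difference {G A : Type*} [AddCommGroup G] [Fintype G]
    [CommRing A] [IsDomain A] (N : AddSubgroup G) (R : Finset G) (k l : ℕ) (χ : AddChar G A)
    (hcard : #R = k)
    (hout : ∀ g ∉ N, {p : G × G | p.1 ∈ R ∧ p.2 ∈ R ∧ p.1 - p.2 = g}.ncard = l)
    (hin : ∀ g ∈ N, g ≠ 0 → {p : G × G | p.1 ∈ R ∧ p.2 ∈ R ∧ p.1 - p.2 = g}.ncard = 0)
    {g₀ : G} (hg₀ : g₀ ∈ N) (hχ : χ g₀ ≠ 1) :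
    (∑ r ∈ R, χ r) * ∑ r ∈ R, χ (-r) = k := by
  classical
  have hset (g : G) : {p : G × G | p.1 ∈ R ∧ p.2 ∈ R ∧ p.1 - p.2 = g}.ncard
      = #{p ∈ R ×ˢ R | p.1 - p.2 = g} := by
    rw [← Set.ncard_coe_finset]
    congr 1
    ext p
    simp [and_assoc]
  have hzero : #{p ∈ R ×ˢ R | p.1 - p.2 = 0} = k := by
    rw [← hcard, ← Finset.diag_card R]
    congr 1
    ext p
    simp only [mem_filter, mem_product, mem_diag, sub_eq_zero]
    grind
  have hG : ∑ g, χ g = 0 := AddChar.sum_eq_zero_of_ne_one fun h => hχ (by simp [h])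
  have hN : ∑ g with g ∈ N, χ g = 0 := by
    have : ∑ g : N, (χ.compAddMonoidHom N.subtype) g = 0 :=
      AddChar.sum_eq_zero_of_ne_one fun h => hχ (by
        simpa using DFunLike.congr_fun h ⟨g₀, hg₀⟩)
    rw [← this]
    exact Finset.sum_subtype _ (by simp) _
  calc (∑ r ∈ R, χ r) * ∑ r ∈ R, χ (-r) = ∑ p ∈ R ×ˢ R, χ (p.1 - p.2) := by
        rw [sum_mul_sum, sum_product]
        simp [sub_eq_add_neg, AddChar.map_add_eq_mul]
    _ = ∑ g, #{p ∈ R ×ˢ R | p.1 - p.2 = g} * χ g := by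
        rw [← Finset.sum_fiberwise (R ×ˢ R) (fun p => p.1 - p.2)]
        refine sum_congr rfl fun g _ => ?_
        rw [← nsmul_eq_mul, ← sum_const]
        exact sum_congr rfl fun p hp => by rw [(mem_filter.mp hp).2]
    _ = ∑ g, (l * χ g - (if g ∈ N then l * χ g else 0) + if g = 0 then (k : A) else 0) := by
        refine sum_congr rfl fun g _ => ?_
        by_cases h0 : g = 0
        · subst h0
          simp [hzero]
        · by_cases h : g ∈ N
          · have := hin g h h0
            rw [hset] at this
            simp [this, h, h0]
          · have := hout g h
            rw [hset] at this
            simp [this, h, h0]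
    _ = k := by
        rw [sum_add_distrib, sum_sub_distrib, ← mul_sum, hG, ← sum_filter, ← mul_sum, hN]
        simp

open scoped Pointwise in
theorem Ideal.emultiplicity_span_smul {A G : Type*} [CommRing A] [IsDedekindDomain A] [Group G]
    [MulSemiringAction G A] (σ : G) (P : Ideal A) (x : A) :
    emultiplicity P (Ideal.span {σ • x}) = emultiplicity (σ⁻¹ • P) (Ideal.span {x}) := by
  rw [emultiplicity_eq_emultiplicity_iff]
  intro n
  rw [Ideal.dvd_span_singleton, Ideal.dvd_span_singleton, ← smul_pow',
    Ideal.mem_inv_pointwise_smul_iff]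

open scoped Pointwise in
theorem associated_smul_of_mul_smul_eq {A G : Type*} [CommRing A] [IsDedekindDomain A] [Group G]
    [MulSemiringAction G A] {σ c : G} (hcomm : Commute σ c) {x k : A} (hx : x * c • x = k)
    (hk : k ≠ 0) (hσk : σ • k = k)
    (hP : ∀ P : Ideal A, P.IsPrime → k ∈ P → σ • P = P ∨ c • P = P) :
    Associated (σ • x) x := by
  classical
  have hx0 : x ≠ 0 := by rintro rfl; simp at hx; exact hk hx.symm
  have hσx0 : σ • x ≠ 0 := (smul_ne_zero_iff_ne σ).mpr hx0
  have hv_half (P : Ideal A) (hPp : Prime P) (hc : c⁻¹ • P = P) :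
      emultiplicity P (Ideal.span {x}) + emultiplicity P (Ideal.span {x})
        = emultiplicity P (Ideal.span {k}) := by
    rw [← hx, ← Ideal.span_singleton_mul_span_singleton, emultiplicity_mul hPp,
      Ideal.emultiplicity_span_smul, hc]
  have hdouble {a b : ℕ∞} (h : a + a = b + b) : a = b := by
    induction a <;> induction b <;> norm_cast at h ⊢
    omega
  have key (P : Ideal A) (hPp : Prime P) :
      emultiplicity P (Ideal.span {σ • x}) = emultiplicity P (Ideal.span {x}) := by
    have hprime := Ideal.isPrime_of_prime hPp
    rw [Ideal.emultiplicity_span_smul]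
    by_cases hkP : k ∈ P
    · rcases hP P hprime hkP with h | h
      · rw [inv_smul_eq_iff.mpr h.symm]
      · have hc : c⁻¹ • P = P := inv_smul_eq_iff.mpr h.symm
        have hσP : Prime (σ⁻¹ • P) := by
          refine Ideal.prime_of_isPrime ?_ inferInstance
          intro h0
          apply hPp.ne_zero
          rw [inv_smul_eq_iff, Ideal.smul_bot] at h0
          exact h0
        have hcσ : c⁻¹ • σ⁻¹ • P = σ⁻¹ • P := by
          rw [smul_smul, ← (hcomm.inv_inv).eq, ← smul_smul, hc]
        apply hdouble
        rw [hv_half P hPp hc, hv_half _ hσP hcσ, ← Ideal.emultiplicity_span_smul, hσk]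
    · have h1 : x ∉ P := fun h => hkP (hx ▸ P.mul_mem_right _ h)
      have h2 : σ • x ∉ P := fun h => hkP (by
        rw [← hσk, ← hx, smul_mul']
        exact P.mul_mem_right _ h)
      rw [← Ideal.emultiplicity_span_smul, emultiplicity_eq_zero.mpr, emultiplicity_eq_zero.mpr] <;>
        rwa [Ideal.dvd_span_singleton]
  have hs0 {y : A} (hy : y ≠ 0) : Ideal.span {y} ≠ 0 := by simpa [Ideal.zero_eq_bot] using hy
  rw [← Ideal.span_singleton_eq_span_singleton]
  rw [← associated_iff_eq,
    UniqueFactorizationMonoid.associated_iff_normalizedFactors_eq_normalizedFactors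
      (hs0 hσx0) (hs0 hx0)]
  ext P
  by_cases hPp : Prime P
  · have h := key P hPp
    rw [UniqueFactorizationMonoid.emultiplicity_eq_count_normalizedFactors hPp.irreducible
        (hs0 hσx0),
      UniqueFactorizationMonoid.emultiplicity_eq_count_normalizedFactors hPp.irreducible (hs0 hx0),
      normalize_eq] at h
    exact_mod_cast h
  · rw [Multiset.count_eq_zero_of_notMem, Multiset.count_eq_zero_of_notMem] <;>
    exact fun h => hPp (UniqueFactorizationMonoid.prime_of_normalized_factor P h)

open scoped Pointwise in
theorem smul_eq_of_forall_sub_pow_mem {A G : Type*} [CommRing A] [Group G]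
    [MulSemiringAction G A] {σ : G} {P : Ideal A} [P.IsPrime] {n : ℕ} (hn : n ≠ 0)
    (h : ∀ x : A, σ • x - x ^ n ∈ P) : σ • P = P := by
  have (x : A) : σ • x ∈ P ↔ x ∈ P := by
    refine ⟨fun hx => Ideal.IsPrime.mem_of_pow_mem ‹_› n ((P.sub_mem_iff_right hx).mp (h x)),
      fun hx => (P.sub_mem_iff_left (P.pow_mem_of_mem hx n (by omega))).mp (h x)⟩
  ext x
  rw [Ideal.mem_pointwise_smul_iff_inv_smul_mem, ← this, smul_inv_smul]

open scoped Pointwise in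
theorem smul_eq_of_smul_eq_pow_prime {A G : Type*} [CommRing A] [Group G]
    [MulSemiringAction G A] {σ : G} {ζ : A} (hζ : Algebra.adjoin ℤ {ζ} = ⊤) {p : ℕ} (hp : p.Prime)
    (hσ : σ • ζ = ζ ^ p) {P : Ideal A} [P.IsPrime] (hpP : (p : A) ∈ P) : σ • P = P := by
  have : Fact p.Prime := ⟨hp⟩
  have : CharP (A ⧸ P) p := (CharP.charP_iff_prime_eq_zero hp).mpr
    (by simpa using Ideal.Quotient.eq_zero_iff_mem.mpr hpP)
  refine smul_eq_of_forall_sub_pow_mem hp.ne_zero fun x => ?_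
  have heq : ((Ideal.Quotient.mk P).comp (MulSemiringAction.toRingHom G A σ)).toIntAlgHom
      = ((frobenius (A ⧸ P) p).comp (Ideal.Quotient.mk P)).toIntAlgHom := by
    refine AlgHom.ext_of_adjoin_eq_top hζ ?_
    simp [Set.EqOn, frobenius_def, hσ]
  rw [← Ideal.Quotient.eq]
  simpa [frobenius_def] using DFunLike.congr_fun heq x

open scoped Pointwise in
theorem smul_eq_of_mem_of_pow_prime_pow_eq_one {A G : Type*} [CommRing A] [Group G]
    [MulSemiringAction G A] {σ : G} {ζ : A} (hζ : Algebra.adjoin ℤ {ζ} = ⊤) {q e s : ℕ}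
    (hq : q.Prime) (hζ1 : ζ ^ q ^ e = 1) (hσ : σ • ζ = ζ ^ s) {P : Ideal A} [P.IsPrime]
    (hqP : (q : A) ∈ P) : σ • P = P := by
  have : Fact q.Prime := ⟨hq⟩
  have : CharP (A ⧸ P) q := (CharP.charP_iff_prime_eq_zero hq).mpr
    (by simpa using Ideal.Quotient.eq_zero_iff_mem.mpr hqP)
  have hz : Ideal.Quotient.mk P ζ = 1 := by
    have h := sub_pow_char_pow (Ideal.Quotient.mk P ζ) 1 e (p := q)
    rw [← map_pow, hζ1, map_one, one_pow, sub_self] at h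
    exact sub_eq_zero.mp (eq_zero_of_pow_eq_zero h)
  refine smul_eq_of_forall_sub_pow_mem one_ne_zero fun x => ?_
  have heq : ((Ideal.Quotient.mk P).comp (MulSemiringAction.toRingHom G A σ)).toIntAlgHom
      = (Ideal.Quotient.mk P).toIntAlgHom := by
    refine AlgHom.ext_of_adjoin_eq_top hζ ?_
    simp [Set.EqOn, hσ, hz]
  rw [← Ideal.Quotient.eq]
  simpa using DFunLike.congr_fun heq x

theorem ZMod.units_eq_one_or_neg_one_of_sq_eq_one {q e : ℕ} (hq : q.Prime) (hq2 : q ≠ 2)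
    {a : (ZMod (q ^ e))ˣ} (ha : a ^ 2 = 1) : a = 1 ∨ a = -1 := by
  obtain ⟨z, hz⟩ := ZMod.intCast_surjective (a : ZMod (q ^ e))
  have hdvd : ((q ^ e : ℕ) : ℤ) ∣ (z - 1) * (z + 1) := by
    rw [← ZMod.intCast_zmod_eq_zero_iff_dvd]
    have : (a : ZMod (q ^ e)) ^ 2 = 1 := by
      rw [← Units.val_pow_eq_pow_val, ha, Units.val_one]
    push_cast
    rw [hz]
    linear_combination this
  have hqi : Prime (q : ℤ) := Nat.prime_iff_prime_int.mp hq
  push_cast at hdvd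
  by_cases h : (q : ℤ) ∣ z - 1
  · have h' : ¬ (q : ℤ) ∣ z + 1 := fun h' => hq2 <| by
      have : (q : ℤ) ∣ (2 : ℕ) := by
        have := dvd_sub h' h
        ring_nf at this
        simpa using this
      exact (Nat.prime_dvd_prime_iff_eq hq Nat.prime_two).mp (Int.natCast_dvd_natCast.mp this)
    left
    have := (((Prime.coprime_iff_not_dvd hqi).mpr h').pow_left (m := e)).dvd_of_dvd_mul_right hdvd
    have := (ZMod.intCast_zmod_eq_zero_iff_dvd _ (q ^ e)).mpr (by exact_mod_cast this)
    ext
    push_cast at this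
    rw [hz] at this
    simpa using sub_eq_zero.mp this
  · right
    have := (((Prime.coprime_iff_not_dvd hqi).mpr h).pow_left (m := e)).dvd_of_dvd_mul_left hdvd
    have := (ZMod.intCast_zmod_eq_zero_iff_dvd _ (q ^ e)).mpr (by exact_mod_cast this)
    ext
    push_cast at this
    rw [hz] at this
    simpa using eq_neg_of_add_eq_zero_left this

theorem exists_dvd_mul_sub_one_add {q e r : ℕ} (hq : q.Prime) (hq2 : q ≠ 2) (hr : r ≠ 0)
    {s : ℕ} (hs : ∀ t : ℕ, (q : ℤ) ^ e ∣ (s : ℤ) ^ t - 1 → q ^ (e - 1) * r ∣ t) {j : ℤ}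
    (hj : (q : ℤ) ^ e ∣ j * ∑ t ∈ range (q ^ (e - 1) * r), (s : ℤ) ^ t) :
    ∃ i : ℕ, (q : ℤ) ^ e ∣ i * (s - 1) + j := by
  have hqi : Prime (q : ℤ) := Nat.prime_iff_prime_int.mp hq
  have : NeZero (q ^ e) := ⟨pow_ne_zero _ hq.ne_zero⟩
  have inv {w : ℤ} (hw : ¬ (q : ℤ) ∣ w) (j : ℤ) : ∃ i : ℕ, (q : ℤ) ^ e ∣ i * w + j := by
    obtain ⟨a, b, hab⟩ := ((Prime.coprime_iff_not_dvd hqi).mpr hw).pow_left (m := e)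
    obtain ⟨i, hi⟩ := ZMod.natCast_zmod_surjective (n := q ^ e) ((-j * b : ℤ) : ZMod (q ^ e))
    refine ⟨i, ?_⟩
    have h1 := (ZMod.intCast_zmod_eq_zero_iff_dvd (i * w + j) (q ^ e)).mp (by
      have := congrArg (Int.cast (R := ZMod (q ^ e))) hab
      push_cast at this hi ⊢
      rw [hi]
      have h0 : (q : ZMod (q ^ e)) ^ e = 0 := by exact_mod_cast ZMod.natCast_self (q ^ e)
      rw [h0] at this
      linear_combination (-j : ZMod (q ^ e)) * this)
    exact_mod_cast h1
  by_cases hqs : (q : ℤ) ∣ s - 1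
  swap
  · exact inv hqs j
  obtain _ | _ | e := e
  · exact ⟨0, by simp⟩
  · refine ⟨0, ?_⟩
    have := hs 1 (by simpa using hqs)
    obtain rfl : r = 1 := by simpa using this
    simpa using hj
  have hq2' : Odd q := hq.odd_of_ne_two hq2
  have hqs' : ¬ (q : ℤ) ∣ s := fun h => hqi.not_dvd_one (by simpa using dvd_sub h hqs)
  have hlte (t : ℕ) := Int.emultiplicity_pow_sub_pow hq hq2' (x := s) (y := 1) hqs hqs' (q ^ t)
  have hv (t : ℕ) : emultiplicity q (q ^ t) = t :=
    emultiplicity_pow_self_of_prime hq.prime t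
  simp only [hv, one_pow] at hlte
  simp only [Nat.add_sub_cancel] at hs hj
  obtain rfl : r = 1 := by
    have := hs (q ^ (e + 1)) (by
      rw [pow_dvd_iff_le_emultiplicity, hlte]
      have := (pow_dvd_iff_le_emultiplicity (k := 1)).mp (by simpa using hqs)
      push_cast
      rw [add_comm]
      gcongr
      exact_mod_cast this)
    have hpos : 0 < q ^ (e + 1) := pow_pos hq.pos _
    have := Nat.le_of_dvd hpos this
    have : r ≤ 1 := by
      by_contra! h
      nlinarith
    omega
  rw [mul_one] at hs hj
  have hqj : (q : ℤ) ∣ j := by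
    by_contra hqj
    have hS := (((Prime.coprime_iff_not_dvd hqi).mpr hqj).pow_left
      (m := e + 1 + 1)).dvd_of_dvd_mul_left hj
    by_cases hs1 : (s : ℤ) = 1
    · simp only [hs1, one_pow, sum_const, card_range, nsmul_eq_mul, mul_one] at hS
      have := (Nat.pow_dvd_pow_iff_le_right hq.one_lt).mp
        (Int.natCast_dvd_natCast.mp (by exact_mod_cast hS))
      omega
    · have hm := geom_sum_mul (s : ℤ) (q ^ (e + 1))
      have hl := hlte (e + 1)
      rw [← hm, emultiplicity_mul hqi, add_comm] at hl
      have hfin : emultiplicity (q : ℤ) (s - 1) ≠ ⊤ := by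
        rw [← finiteMultiplicity_iff_emultiplicity_ne_top, Int.finiteMultiplicity_iff]
        exact ⟨by simpa using hq.ne_one, sub_ne_zero.mpr hs1⟩
      have hl' := (ENat.addLECancellable_of_ne_top hfin).inj.mp hl
      have := pow_dvd_iff_le_emultiplicity.mp hS
      rw [hl'] at this
      norm_cast at this
      omega
  obtain ⟨w, hw⟩ := hqs
  obtain ⟨j', rfl⟩ := hqj
  have hqw : ¬ (q : ℤ) ∣ w := by
    rintro ⟨w', rfl⟩
    have := hs (q ^ e) (by
      rw [pow_dvd_iff_le_emultiplicity, hlte]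
      have := (pow_dvd_iff_le_emultiplicity (k := 2) (a := (q : ℤ)) (b := s - 1)).mp
        ⟨w', by rw [hw]; ring⟩
      rw [add_assoc, one_add_one_eq_two]
      push_cast
      rw [add_comm]
      gcongr
      exact_mod_cast this)
    have := (Nat.pow_dvd_pow_iff_le_right hq.one_lt).mp this
    omega
  obtain ⟨i, hi⟩ := inv hqw j'
  refine ⟨i, hi.trans ⟨q, ?_⟩⟩
  rw [hw]
  ring

theorem IsPrimitiveRoot.exists_sq_eq_neg_of_mod_four_eq_three {A : Type*} [CommRing A] [IsDomain A]
    [CharZero A] {q : ℕ} (hq : q.Prime) (hq3 : q % 4 = 3) {ζ : A} (hζ : IsPrimitiveRoot ζ q) :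
    ∃ w : A, w ^ 2 = -q := by
  have : Fact q.Prime := ⟨hq⟩
  have hchar : ringChar (ZMod q) ≠ 2 := by
    rw [ZMod.ringChar_zmod_n]
    rintro rfl
    simp at hq3
  let χ : MulChar (ZMod q) A := (quadraticChar (ZMod q)).ringHomComp (Int.castRingHom A)
  have hχ : χ ≠ 1 :=
    (MulChar.ringHomComp_ne_one_iff (RingHom.injective_int _)).mpr (quadraticChar_ne_one hchar)
  have hquad : χ.IsQuadratic := (quadraticChar_isQuadratic (ZMod q)).comp _
  refine ⟨_, (gaussSum_sq hχ hquad (AddChar.zmodChar_primitive_of_primitive_root q hζ)).trans ?_⟩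
  simp [χ, quadraticChar_neg_one hchar, ZMod.χ₄_nat_three_mod_four hq3]

theorem exists_four_mul_eq_sq_add_mul_sq {A G : Type*} [CommRing A] [IsDomain A] [CharZero A]
    [Group G] [MulSemiringAction G A] {τ : G} (hinv : ∀ x : A, τ • x = x → ∃ z : ℤ, x = z)
    {q k : ℕ} (hq : q.Prime) {w : A} (hw : w ^ 2 = -q) {y : A} (hy : τ • τ • y = y)
    (hk : y * τ • y = k) : ∃ a b : ℤ, 4 * (k : ℤ) = a ^ 2 + q * b ^ 2 := by
  have hτw : τ • w = -w := by
    have h : (τ • w) ^ 2 = w ^ 2 := by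
      rw [← smul_pow', hw, smul_neg]
      exact congrArg _ (map_natCast (MulSemiringAction.toRingHom G A τ) q)
    refine (sq_eq_sq_iff_eq_or_eq_neg.mp h).resolve_left fun h => ?_
    obtain ⟨z, rfl⟩ := hinv w h
    have : z ^ 2 = -q := by
      apply Int.cast_injective (α := A)
      push_cast
      exact hw
    have := hq.pos
    nlinarith [sq_nonneg z]
  obtain ⟨a, ha⟩ := hinv (y + τ • y) (by rw [smul_add, hy, add_comm])
  obtain ⟨z, hz⟩ := hinv ((y - τ • y) * w) (by
    rw [smul_mul', smul_sub, hy, hτw]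
    ring)
  have hmul : z ^ 2 = -q * (a ^ 2 - 4 * k) := by
    have : (z : A) ^ 2 = -q * (a ^ 2 - 4 * k) := by
      rw [← ha, ← hz, ← hk, mul_pow, hw]
      ring
    apply Int.cast_injective (α := A)
    push_cast
    exact this
  have hqz : (q : ℤ) ∣ z :=
    (Nat.prime_iff_prime_int.mp hq).dvd_of_dvd_pow ⟨-(a ^ 2 - 4 * k), by rw [hmul]; ring⟩
  obtain ⟨b, rfl⟩ := hqz
  refine ⟨a, b, ?_⟩
  have hq0 : (q : ℤ) ≠ 0 := by exact_mod_cast hq.ne_zero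
  apply mul_left_cancel₀ hq0
  linear_combination -hmul

theorem exists_smul_root_mul_eq_self {A G : Type*} [CommRing A] [IsDomain A] [CharZero A] [Group G]
    [MulSemiringAction G A] {σ : G} {q e h : ℕ} (hq : q.Prime) (hq2 : q ≠ 2) (hr : h ≠ 0)
    (hodd : Odd (q ^ (e - 1) * h)) (hσ : σ ^ (q ^ (e - 1) * h) = 1) {ζ : A}
    (hζ : IsPrimitiveRoot ζ (q ^ e)) {s : ℕ} (hs : σ • ζ = ζ ^ s)
    (hst : ∀ t : ℕ, (q : ℤ) ^ e ∣ (s : ℤ) ^ t - 1 → q ^ (e - 1) * h ∣ t) {x : A} (hx0 : x ≠ 0)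
    {r : ℕ} (hx : σ • x = x * (-ζ) ^ r) : ∃ i : ℕ, σ • (ζ ^ i * x) = ζ ^ i * x := by
  have hqodd : Odd q := hq.odd_of_ne_two hq2
  have hiter (i : ℕ) : σ ^ i • x = x * (((-1) ^ r) ^ i * ζ ^ (r * ∑ t ∈ range i, s ^ t)) := by
    induction i with
    | zero => simp
    | succ i ih =>
      rw [pow_succ', mul_smul, ih, smul_mul', smul_mul', hx, smul_pow', smul_pow', smul_pow',
        smul_neg, smul_one, hs, geom_sum_succ, neg_pow]
      ring
  have hone : ((-1 : A) ^ r) ^ (q ^ (e - 1) * h)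
      * ζ ^ (r * ∑ t ∈ range (q ^ (e - 1) * h), s ^ t) = 1 := by
    have := hiter (q ^ (e - 1) * h)
    rw [hσ, one_smul] at this
    exact (mul_eq_left₀ hx0).mp this.symm
  have hreven : Even r := by
    have := congrArg (· ^ q ^ e) hone
    simp only [mul_pow, one_pow] at this
    rw [pow_right_comm ζ, hζ.pow_eq_one, one_pow, mul_one, ← pow_mul, ← pow_mul] at this
    by_contra hr
    rw [Nat.not_even_iff_odd] at hr
    rw [(hr.mul (hodd.mul hqodd.pow)).neg_one_pow] at this
    norm_num at this
  rw [hreven.neg_one_pow, one_pow, one_mul, hζ.pow_eq_one_iff_dvd] at hone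
  obtain ⟨i, hi⟩ := exists_dvd_mul_sub_one_add hq hq2 hr hst (j := r) (by exact_mod_cast hone)
  refine ⟨i, ?_⟩
  have hmod : s * i + r ≡ i [MOD q ^ e] := by
    rw [Nat.modEq_iff_dvd]
    obtain ⟨m, hm⟩ := hi
    exact ⟨-m, by push_cast; linear_combination -hm⟩
  rw [smul_mul', smul_pow', hs, hx, hreven.neg_pow, ← pow_mul, mul_left_comm, ← pow_add,
    pow_eq_pow_mod _ hζ.pow_eq_one, hmod, ← pow_eq_pow_mod _ hζ.pow_eq_one, mul_comm]

theorem IsPrimitiveRoot.exists_eq_neg_pow_of_mul_smul_eq_one {K : Type*} [Field K] [NumberField K]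
    {N : ℕ} [NeZero N] [IsCyclotomicExtension {N} ℚ K] (hN : Odd N) {ζ : K}
    (hζ : IsPrimitiveRoot ζ N) {c : Gal(K/ℚ)} (hc : hζ.toInteger * c • hζ.toInteger = 1) {u : 𝓞 K}
    (hu : u * c • u = 1) : ∃ r : ℕ, u = (-hζ.toInteger) ^ r := by
  have hconj (f : K →+* ℂ) (x : 𝓞 K) : f (c • x : 𝓞 K) = (starRingEnd ℂ) (f x) := by
    let g : 𝓞 K →+* ℂ := f.comp (algebraMap (𝓞 K) K)
    have heq : (g.comp (MulSemiringAction.toRingHom Gal(K/ℚ) (𝓞 K) c)).toIntAlgHom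
        = ((starRingEnd ℂ).comp g).toIntAlgHom := by
      refine AlgHom.ext_of_adjoin_eq_top
        (IsCyclotomicExtension.Rat.adjoin_singleton_eq_top hζ) ?_
      rintro _ rfl
      have hnorm : ‖g hζ.toInteger‖ = 1 :=
        Complex.norm_eq_one_of_pow_eq_one (n := N)
          (by rw [← map_pow, hζ.toInteger_isPrimitiveRoot.pow_eq_one, map_one]) (NeZero.ne N)
      change g (c • hζ.toInteger) = (starRingEnd ℂ) (g hζ.toInteger)
      rw [← Complex.inv_eq_conj hnorm]
      exact eq_inv_of_mul_eq_one_right (by rw [← map_mul, hc, map_one])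
    exact DFunLike.congr_fun heq x
  obtain ⟨n, hn, hun⟩ := NumberField.Embeddings.pow_eq_one_of_norm_eq_one K ℂ (x := u)
    u.isIntegral_coe fun f => by
      have h1 : f u * (starRingEnd ℂ) (f u) = 1 := by
        rw [← hconj, ← map_mul, ← map_mul, hu, map_one, map_one]
      rw [Complex.mul_conj, Complex.normSq_eq_norm_sq] at h1
      have h2 : ‖f u‖ ^ 2 = 1 := by exact_mod_cast h1
      exact (pow_eq_one_iff_of_nonneg (norm_nonneg _) two_ne_zero).mp h2
  obtain ⟨r, hr⟩ := hζ.exists_neg_pow_of_isOfFinOrder hN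
    (isOfFinOrder_iff_pow_eq_one.mpr ⟨n, hn, hun⟩)
  refine ⟨r, FaithfulSMul.algebraMap_injective (𝓞 K) K ?_⟩
  rw [map_pow, map_neg]
  exact hr

theorem Ideal.IsPrime.exists_prime_dvd_natCast_mem {A : Type*} [CommRing A] {P : Ideal A}
    (hP : P.IsPrime) {k : ℕ} (hk0 : k ≠ 0) (hk : (k : A) ∈ P) :
    ∃ p : ℕ, p.Prime ∧ p ∣ k ∧ (p : A) ∈ P := by
  induction k using induction_on_primes with
  | zero => exact absurd rfl hk0
  | one => exact absurd (P.eq_top_iff_one.mpr (by simpa using hk)) hP.ne_top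
  | prime_mul p a hp ih =>
    rw [Nat.cast_mul] at hk
    rcases hP.mem_or_mem hk with h | h
    · exact ⟨p, hp, dvd_mul_right _ _, h⟩
    · obtain ⟨p', hp', hdvd, hmem⟩ := ih (right_ne_zero_of_mul hk0) h
      exact ⟨p', hp', hdvd.mul_left p, hmem⟩

theorem ZMod.neg_one_mem_zpowers_of_even_orderOf {q e : ℕ} (hq : q.Prime) (hq2 : q ≠ 2)
    {a : (ZMod (q ^ e))ˣ} (ha : Even (orderOf a)) : -1 ∈ Subgroup.zpowers a := by
  have : NeZero (q ^ e) := ⟨pow_ne_zero _ hq.ne_zero⟩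
  obtain ⟨m, hm⟩ := ha
  have hpos := orderOf_pos a
  refine ⟨m, ?_⟩
  have hsq : (a ^ m) ^ 2 = 1 := by rw [← pow_mul, mul_two, ← hm, pow_orderOf_eq_one]
  have hne : a ^ m ≠ 1 := fun h => by
    have := Nat.le_of_dvd (by omega) (orderOf_dvd_of_pow_eq_one h)
    omega
  simpa using (units_eq_one_or_neg_one_of_sq_eq_one hq hq2 hsq).resolve_left hne

section Cyclotomic

open IsCyclotomicExtension.Rat

variable {K : Type*} [Field K] [NumberField K] {q e : ℕ} [NeZero (q ^ e)]
  [IsCyclotomicExtension {q ^ e} ℚ K]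

theorem IsPrimitiveRoot.smul_toInteger_eq_pow {N : ℕ} [NeZero N] [IsCyclotomicExtension {N} ℚ K]
    {ζ : K} (hζ : IsPrimitiveRoot ζ N) (ρ : Gal(K/ℚ)) {s : ℕ}
    (hs : (s : ZMod N) = (galEquivZMod N K ρ : ZMod N)) :
    ρ • hζ.toInteger = hζ.toInteger ^ s := by
  rw [galEquivZMod_smul_of_pow_eq N K ρ hζ.toInteger_isPrimitiveRoot.pow_eq_one, ← hs,
    ZMod.val_natCast, ← pow_eq_pow_mod _ hζ.toInteger_isPrimitiveRoot.pow_eq_one]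

open scoped Pointwise in
theorem smul_eq_or_smul_eq_of_orderOf (hq : q.Prime) (hq2 : q ≠ 2) {h : ℕ}
    (hcard : Nat.card (ZMod (q ^ e))ˣ = 2 * h) (hh : h ≠ 0)
    {g : (ZMod (q ^ e))ˣ} {c σ : Gal(K/ℚ)} (hc : galEquivZMod (q ^ e) K c = -1)
    (hσ : galEquivZMod (q ^ e) K σ = g ^ 2) {p : ℕ} (hp : p.Prime)
    (hord : Even (orderOf (p : ZMod (q ^ e))) ∨ orderOf (p : ZMod (q ^ e)) = h ∨ p = q)
    {P : Ideal (𝓞 K)} (hP : P.IsPrime) (hpP : (p : 𝓞 K) ∈ P) : σ • P = P ∨ c • P = P := by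
  obtain ⟨ζ, hζ⟩ := IsCyclotomicExtension.exists_isPrimitiveRoot ℚ K (Set.mem_singleton (q ^ e))
    (NeZero.ne _)
  have hadj := adjoin_singleton_eq_top hζ
  by_cases hpq : p = q
  · subst hpq
    exact .inl (smul_eq_of_mem_of_pow_prime_pow_eq_one hadj hp
      hζ.toInteger_isPrimitiveRoot.pow_eq_one
      (hζ.smul_toInteger_eq_pow σ (ZMod.natCast_zmod_val _)) hpP)
  have hcop : p.Coprime (q ^ e) := ((Nat.coprime_primes hp hq).mpr hpq).pow_right e
  let a := ZMod.unitOfCoprime p hcop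
  let φ : Gal(K/ℚ) := (galEquivZMod (q ^ e) K).symm a
  have hφ : φ ∈ MulAction.stabilizer Gal(K/ℚ) P :=
    smul_eq_of_smul_eq_pow_prime hadj hp (hζ.smul_toInteger_eq_pow φ (by
      rw [MulEquiv.apply_symm_apply, ZMod.coe_unitOfCoprime])) hpP
  have hmem {ρ : Gal(K/ℚ)} (hρ : galEquivZMod (q ^ e) K ρ ∈ Subgroup.zpowers a) : ρ • P = P := by
    obtain ⟨z, hz⟩ := hρ
    have : ρ = φ ^ z := by
      rw [← map_zpow]
      exact (MulEquiv.eq_symm_apply _).mpr hz.symm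
    rw [this]
    exact Subgroup.zpow_mem _ hφ z
  have ha : orderOf (p : ZMod (q ^ e)) = orderOf a := by
    rw [← orderOf_units, ZMod.coe_unitOfCoprime]
  rw [ha] at hord
  rcases hord with heven | hhalf | hpq'
  · exact .inr (hmem (hc ▸ ZMod.neg_one_mem_zpowers_of_even_orderOf hq hq2 heven))
  · refine .inl (hmem (hσ ▸ Subgroup.sq_mem_of_index_two ?_ g))
    have := (Subgroup.zpowers a).card_mul_index
    rw [Nat.card_zpowers, hhalf, hcard, mul_comm 2] at this
    exact Nat.eq_of_mul_eq_mul_left (by omega) this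
  · exact absurd hpq' hpq

theorem exists_four_mul_eq_of_mul_smul_eq (hq : q.Prime) (hq3 : q % 4 = 3) (he : 1 ≤ e)
    {c : Gal(K/ℚ)} (hc : galEquivZMod (q ^ e) K c = -1) {x : 𝓞 K} {k : ℕ} (hk0 : k ≠ 0)
    (hx : x * c • x = k)
    (hprimes : ∀ p : ℕ, p.Prime → p ∣ k →
      Even (orderOf (p : ZMod (q ^ e))) ∨
        orderOf (p : ZMod (q ^ e)) = q ^ (e - 1) * (q - 1) / 2 ∨ p = q) :
    ∃ a b : ℤ, 4 * (k : ℤ) = a ^ 2 + q * b ^ 2 := by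
  have hq2 : q ≠ 2 := by rintro rfl; simp at hq3
  obtain ⟨ζ, hζ⟩ := IsCyclotomicExtension.exists_isPrimitiveRoot ℚ K (Set.mem_singleton (q ^ e))
    (NeZero.ne _)
  have hζ' := hζ.toInteger_isPrimitiveRoot
  have : IsGalois ℚ K := IsCyclotomicExtension.isGalois {q ^ e} ℚ K
  have := ZMod.isCyclic_units_of_prime_pow q hq hq2 e
  obtain ⟨g, hg⟩ := IsCyclic.exists_generator (α := (ZMod (q ^ e))ˣ)
  obtain ⟨r, hr⟩ : ∃ r, q = 4 * r + 3 := ⟨q / 4, by omega⟩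
  have hh : q ^ (e - 1) * (q - 1) / 2 = q ^ (e - 1) * (2 * r + 1) := by
    rw [show q - 1 = 2 * (2 * r + 1) by omega, mul_left_comm, Nat.mul_div_cancel_left _ two_pos]
  rw [hh] at hprimes
  set h := q ^ (e - 1) * (2 * r + 1) with h_def
  have hodd : Odd h := (hq.odd_of_ne_two hq2).pow.mul ⟨r, rfl⟩
  have hpos : 0 < h := hodd.pos
  have hcard : Nat.card (ZMod (q ^ e))ˣ = 2 * h := by
    rw [Nat.card_eq_fintype_card, ZMod.card_units_eq_totient, Nat.totient_prime_pow hq he,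
      show q - 1 = 2 * (2 * r + 1) by omega, mul_left_comm]
  have hordg : orderOf g = 2 * h := by rw [orderOf_eq_card_of_forall_mem_zpowers hg, hcard]
  have hgh : g ^ h = -1 := by
    refine (ZMod.units_eq_one_or_neg_one_of_sq_eq_one hq hq2 ?_).resolve_left fun h1 => ?_
    · rw [← pow_mul, mul_comm, ← hordg, pow_orderOf_eq_one]
    · have := Nat.le_of_dvd hpos (orderOf_dvd_of_pow_eq_one h1)
      omega
  let τ : Gal(K/ℚ) := (galEquivZMod (q ^ e) K).symm g
  have hτ : galEquivZMod (q ^ e) K τ = g := MulEquiv.apply_symm_apply _ _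
  have hcτ : c = τ ^ h := by
    apply (galEquivZMod (q ^ e) K).injective
    rw [map_pow, hτ, hgh, hc]
  have hσ : galEquivZMod (q ^ e) K (τ ^ 2) = g ^ 2 := by rw [map_pow, hτ]
  have hk0' : (k : 𝓞 K) ≠ 0 := by exact_mod_cast hk0
  have hnat (ρ : Gal(K/ℚ)) : ρ • (k : 𝓞 K) = k :=
    map_natCast (MulSemiringAction.toRingHom Gal(K/ℚ) (𝓞 K) ρ) k
  have hcomm : Commute (τ ^ 2) c := hcτ ▸ (Commute.refl τ).pow_pow 2 h
  have hx0 : x ≠ 0 := by rintro rfl; exact hk0' (by rw [← hx, zero_mul])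
  obtain ⟨u, hu⟩ : Associated x (τ ^ 2 • x) :=
    (associated_smul_of_mul_smul_eq hcomm hx hk0' (hnat _) fun P hP hkP => by
      obtain ⟨p, hp, hpk, hpP⟩ := hP.exists_prime_dvd_natCast_mem hk0 hkP
      exact smul_eq_or_smul_eq_of_orderOf hq hq2 hcard hpos.ne' hc hσ hp (hprimes p hp hpk)
        hP hpP).symm
  have hu1 : (u : 𝓞 K) * c • (u : 𝓞 K) = 1 := by
    have := hnat (τ ^ 2)
    rw [← hx, smul_mul', smul_smul, hcomm.eq, mul_smul, ← hu, smul_mul'] at this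
    apply mul_left_cancel₀ hk0'
    rw [mul_one, ← hx]
    linear_combination this
  have hcζ : hζ.toInteger * c • hζ.toInteger = 1 := by
    rw [hζ.smul_toInteger_eq_pow c (s := q ^ e - 1)
      (by rw [hc, Nat.cast_sub NeZero.one_le]; simp), ← pow_succ',
      Nat.sub_add_cancel NeZero.one_le, hζ'.pow_eq_one]
  obtain ⟨j, hj⟩ := hζ.exists_eq_neg_pow_of_mul_smul_eq_one (hq.odd_of_ne_two hq2).pow hcζ hu1
  have hord {t : ℕ} (ht : (g ^ 2) ^ t = 1) : h ∣ t := by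
    rw [← pow_mul] at ht
    exact Nat.dvd_of_mul_dvd_mul_left two_pos (hordg ▸ orderOf_dvd_of_pow_eq_one ht)
  obtain ⟨i, hi⟩ := exists_smul_root_mul_eq_self (σ := τ ^ 2) hq hq2 (Nat.succ_ne_zero (2 * r))
    hodd (by
      apply (galEquivZMod (q ^ e) K).injective
      rw [map_pow, map_pow, hτ, map_one, ← pow_mul, ← h_def, ← hordg, pow_orderOf_eq_one]) hζ'
    (hζ.smul_toInteger_eq_pow (τ ^ 2) (ZMod.natCast_zmod_val _)) (fun t ht => hord (by
      rw [hσ] at ht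
      have := (ZMod.intCast_zmod_eq_zero_iff_dvd _ (q ^ e)).mpr (by exact_mod_cast ht)
      push_cast at this
      rw [ZMod.natCast_zmod_val, sub_eq_zero] at this
      ext
      push_cast
      exact_mod_cast this)) hx0 (by rw [← hj, hu])
  set y := hζ.toInteger ^ i * x
  have hcy : c • y = τ • y := by
    obtain ⟨b, hb⟩ := hodd
    have (b : ℕ) : (τ ^ 2) ^ b • y = y := by
      induction b with
      | zero => simp
      | succ b ih => rw [pow_succ, mul_smul, hi, ih]
    rw [hcτ, hb, pow_succ', mul_smul, pow_mul, this]
  obtain ⟨w, hw⟩ := (hζ'.pow (NeZero.pos _) (a := q ^ (e - 1)) (b := q)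
    (by rw [← pow_succ, Nat.sub_add_cancel he])).exists_sq_eq_neg_of_mod_four_eq_three hq hq3
  refine exists_four_mul_eq_sq_add_mul_sq (τ := τ) (y := y) (fun z hz => ?_) hq hw ?_ ?_
  · obtain ⟨n, hn⟩ := Algebra.IsInvariant.isInvariant (A := ℤ) (G := Gal(K/ℚ)) z fun ρ => by
      obtain ⟨m, hm⟩ := hg (galEquivZMod (q ^ e) K ρ)
      have : ρ = τ ^ m := by
        apply (galEquivZMod (q ^ e) K).injective
        rw [map_zpow, hτ]
        exact hm.symm
      rw [this]
      exact Subgroup.zpow_mem (MulAction.stabilizer Gal(K/ℚ) z) hz m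
    exact ⟨n, by simpa using hn.symm⟩
  · rw [smul_smul, ← pow_two, hi]
  · rw [← hcy, smul_mul', smul_pow', mul_mul_mul_comm, ← mul_pow, hcζ, one_pow, one_mul, hx]

end Cyclotomic

/-- Lam's Theorem 3.5: under the stated order conditions on the prime divisors of `k`,
the equation `4k = x² + q y²` has an integer solution. -/
theorem lam_3_5 (m n k l q e : ℕ) (hRDS : IsCyclicAddRDS m n k l)
    (hq : q.Prime) (hq3 : q % 4 = 3) (he : 1 ≤ e)
    (hqe : q ^ e ∣ m * n) (hqe' : ¬ q ^ (e + 1) ∣ m * n) (hqm : ¬ q ^ e ∣ m)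
    (hprimes : ∀ p : ℕ, p.Prime → p ∣ k →
      Even (orderOf (p : ZMod (q ^ e))) ∨
        orderOf (p : ZMod (q ^ e)) = q ^ (e - 1) * (q - 1) / 2 ∨ p = q) :
    ∃ x y : ℤ, 4 * (k : ℤ) = x ^ 2 + q * y ^ 2 := by
  classical
  rcases eq_or_ne k 0 with rfl | hk0
  · exact ⟨0, 0, by simp⟩
  have : NeZero (q ^ e) := ⟨pow_ne_zero _ hq.ne_zero⟩
  have : NeZero (m * n) := ⟨fun h => hqe' (h ▸ dvd_zero _)⟩
  obtain ⟨R, -, -, hcard, hout, hin⟩ := hRDS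
  let K := CyclotomicField (q ^ e) ℚ
  have : IsCyclotomicExtension {q ^ e} ℚ K := CyclotomicField.isCyclotomicExtension _ _
  have : NumberField K := IsCyclotomicExtension.numberField {q ^ e} ℚ K
  obtain ⟨ζ, hζ⟩ := IsCyclotomicExtension.exists_isPrimitiveRoot ℚ K (Set.mem_singleton (q ^ e))
    (NeZero.ne _)
  have hζ' := hζ.toInteger_isPrimitiveRoot
  have hpow : hζ.toInteger ^ (m * n) = 1 := (hζ'.pow_eq_one_iff_dvd _).mpr hqe
  let χ := AddChar.zmodChar (m * n) hpow
  let c := (IsCyclotomicExtension.Rat.galEquivZMod (q ^ e) K).symm (-1)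
  have hc : IsCyclotomicExtension.Rat.galEquivZMod (q ^ e) K c = -1 := MulEquiv.apply_symm_apply _ _
  have hcζ : hζ.toInteger * c • hζ.toInteger = 1 := by
    rw [hζ.smul_toInteger_eq_pow c (s := q ^ e - 1)
      (by rw [hc, Nat.cast_sub NeZero.one_le]; simp), ← pow_succ',
      Nat.sub_add_cancel NeZero.one_le, hζ'.pow_eq_one]
  have hcχ (r : ZMod (m * n)) : c • χ r = χ (-r) := by
    refine left_inv_eq_right_inv (a := χ r) ?_ ?_
    · rw [mul_comm, AddChar.zmodChar_apply, smul_pow', ← mul_pow, hcζ, one_pow]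
    · rw [← AddChar.map_add_eq_mul, add_neg_cancel, AddChar.map_zero_eq_one]
  refine exists_four_mul_eq_of_mul_smul_eq (K := K) hq hq3 he hc (x := ∑ r ∈ R.toFinset, χ r) hk0
    ?_ hprimes
  rw [Finset.smul_sum, Finset.sum_congr rfl fun r _ => hcχ r]
  refine AddChar.sum_eq_of_relative_difference (AddSubgroup.zmultiples (m : ZMod (m * n)))
    R.toFinset k l χ ?_ ?_ ?_ (AddSubgroup.mem_zmultiples _) ?_
  · rw [← hcard, Set.ncard_eq_toFinset_card']
  · simpa using hout
  · simpa using hin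
  · rw [AddChar.zmodChar_apply', Ne, hζ'.pow_eq_one_iff_dvd]
    exact hqm
end
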